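/- arXiv:math/0606292 — 11 statements merged into one kernel-verified Lean document; each statement's English description precedes it below -/
import Mathlib

section
/- Conversely, let τ = (τ^1,…,τ^n) be a random variable taking exactly n+1 distinct values v_0,…,v_n in ℝ^n, each with strictly positive probability p_j, such that E[τ^i] = 0 and E[τ^i τ^j] = δ_{ij} for all i, j ∈ {1,…,n}. Then the (n+1)×(n+1) matrix (e_{i,j}) defined by e_{0,j} := √(p_j) and e_{k,j} := √(p_j) · v_j^k (k = 1,…,n) is orthogonal, has strictly positive first row, and satisfies v_j = (e_{1,j}/e_{0,j},…,e_{n,j}/e_{0,j}) and p_j = e_{0,j}^2 for every j. -/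
/-- The `(n+1) × (n+1)` matrix with entries `e_{0,j} = √(p_j)` and `e_{k,j} = √(p_j)·v_j^k`
(`k = 1, …, n`) built from a distribution `p` on `n+1` points `v_0, …, v_n ∈ ℝ^n`. -/
noncomputable def recMatrix {n : ℕ} (p : Fin (n + 1) → ℝ) (v : Fin (n + 1) → Fin n → ℝ) :
    Matrix (Fin (n + 1)) (Fin (n + 1)) ℝ :=
  Matrix.of fun i j => Fin.cases (Real.sqrt (p j)) (fun k => Real.sqrt (p j) * v j k) i

/-- Conversely, any random variable taking exactly `n+1` distinct values `v_0, …, v_n` with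
strictly positive probabilities `p_j`, mean zero and identity covariance arises from an
orthogonal matrix with strictly positive first row as in He's construction. -/
theorem orthogonal_matrix_from_distribution {n : ℕ} (hn : 1 ≤ n)
    (v : Fin (n + 1) → Fin n → ℝ) (hv : Function.Injective v)
    (p : Fin (n + 1) → ℝ) (hp : ∀ j, 0 < p j) (hpsum : ∑ j, p j = 1)
    (hmean : ∀ i : Fin n, ∑ j, p j * v j i = 0)
    (hcov : ∀ i k : Fin n, ∑ j, p j * (v j i * v j k) = if i = k then 1 else 0) :
    (recMatrix p v).transpose * recMatrix p v = 1 ∧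
      (∀ j, 0 < recMatrix p v 0 j) ∧
      (∀ j (k : Fin n), v j k = recMatrix p v k.succ j / recMatrix p v 0 j) ∧
      (∀ j, p j = (recMatrix p v 0 j) ^ 2) := by
  have h0 : ∀ j, recMatrix p v 0 j = Real.sqrt (p j) := fun j => rfl
  have hS : ∀ (k : Fin n) j, recMatrix p v k.succ j = Real.sqrt (p j) * v j k := fun k j => rfl
  have hs : ∀ j, Real.sqrt (p j) * Real.sqrt (p j) = p j := fun j =>
    Real.mul_self_sqrt (hp j).le
  have hpos : ∀ j, 0 < Real.sqrt (p j) := fun j => Real.sqrt_pos.mpr (hp j)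
  refine ⟨?_, fun j => ?_, fun j k => ?_, fun j => ?_⟩
  · rw [mul_eq_one_comm]
    ext a b
    rw [Matrix.mul_apply]
    simp only [Matrix.transpose_apply]
    refine Fin.cases ?_ (fun i => ?_) a <;> refine Fin.cases ?_ (fun k => ?_) b
    · simp only [h0, hs, hpsum, Matrix.one_apply_eq]
    · rw [Matrix.one_apply_ne (Fin.succ_ne_zero k).symm, ← hmean k]
      refine Finset.sum_congr rfl fun j _ => ?_
      rw [h0, hS, ← mul_assoc, hs]
    · rw [Matrix.one_apply_ne (Fin.succ_ne_zero i), ← hmean i]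
      refine Finset.sum_congr rfl fun j _ => ?_
      rw [h0, hS, mul_right_comm, hs]
    · rw [Matrix.one_apply]
      simp only [Fin.succ_inj]
      rw [← hcov i k]
      refine Finset.sum_congr rfl fun j _ => ?_
      rw [hS, hS, mul_mul_mul_comm, hs]
  · rw [h0]; exact hpos j
  · rw [h0, hS, mul_div_cancel_left₀ _ (hpos j).ne']
  · rw [h0, sq, hs]
end

section
/- The n+1 random variables 1, τ^1, …, τ^n are orthonormal with respect to the inner product ⟨X,Y⟩ = E[XY] and span the space of all real-valued functions of τ; equivalently, for every function g : ℝ^n → ℝ one has, almost surely, g(τ) = E[g(τ)] + Σ_{k=1}^n E[g(τ) τ^k] τ^k. -/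
open MeasureTheory

/-- The `j`-th vector `e_j = (e_{1,j}/e_{0,j}, …, e_{n,j}/e_{0,j}) ∈ ℝ^n`. -/
noncomputable def stepVec {n : ℕ} (E : Matrix (Fin (n + 1)) (Fin (n + 1)) ℝ)
    (j : Fin (n + 1)) : Fin n → ℝ :=
  fun k => E k.succ j / E 0 j

theorem stepVec_inj_aux {n : ℕ} (E : Matrix (Fin (n + 1)) (Fin (n + 1)) ℝ)
    (hE : E.transpose * E = 1) (hEpos : ∀ j, 0 < E 0 j) :
    Function.Injective (stepVec E) := by
  intro i j hij
  by_contra hne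
  have h1 := congrFun (congrFun hE i) j
  rw [Matrix.mul_apply, Matrix.one_apply_ne hne, Fin.sum_univ_succ] at h1
  simp only [Matrix.transpose_apply] at h1
  have h2 : ∀ k : Fin n, 0 ≤ E k.succ i * E k.succ j := by
    intro k
    have h3 := congrFun hij k
    simp only [stepVec] at h3
    have hi := hEpos i
    have hj := hEpos j
    have h4 : E k.succ i = (E k.succ j / E 0 j) * E 0 i := by
      rw [← h3]; field_simp
    have h5 : E k.succ i * E k.succ j = (E k.succ j) ^ 2 * (E 0 i / E 0 j) := by
      rw [h4]; field_simp
    rw [h5]; positivity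
  have h6 := Finset.sum_nonneg (fun k (_ : k ∈ Finset.univ) => h2 k)
  have h7 := mul_pos (hEpos i) (hEpos j)
  linarith

theorem rows_aux {n : ℕ} (E : Matrix (Fin (n + 1)) (Fin (n + 1)) ℝ)
    (hE : E.transpose * E = 1) (a b : Fin (n + 1)) :
    ∑ j, E a j * E b j = if a = b then 1 else 0 := by
  have h0 : E * E.transpose = 1 := mul_eq_one_comm.mp hE
  have h := congrFun (congrFun h0 a) b
  rw [Matrix.mul_apply, Matrix.one_apply] at h
  simpa only [Matrix.transpose_apply] using h

theorem ae_range_aux {n : ℕ}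
    (E : Matrix (Fin (n + 1)) (Fin (n + 1)) ℝ)
    (hE : E.transpose * E = 1) (hEpos : ∀ j, 0 < E 0 j)
    {Ω : Type*} [MeasurableSpace Ω] (μ : Measure Ω) [IsProbabilityMeasure μ]
    (τ : Ω → Fin n → ℝ) (hτm : Measurable τ)
    (hτ : ∀ j, μ {ω | τ ω = stepVec E j} = ENNReal.ofReal ((E 0 j) ^ 2)) :
    ∀ᵐ ω ∂μ, ∃ j, τ ω = stepVec E j := by
  have hm : ∀ j, MeasurableSet {ω | τ ω = stepVec E j} := fun j =>
    hτm (measurableSet_singleton (stepVec E j))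
  have hU : μ (⋃ j, {ω | τ ω = stepVec E j}) = 1 := by
    rw [measure_iUnion _ hm, tsum_fintype]
    · simp only [hτ]
      rw [← ENNReal.ofReal_sum_of_nonneg (fun i _ => sq_nonneg _)]
      have := rows_aux E hE 0 0
      simp only [if_true, ← pow_two] at this
      rw [this, ENNReal.ofReal_one]
    · intro i j hij
      rw [Function.onFun, Set.disjoint_left]
      intro ω h1 h2
      exact hij (stepVec_inj_aux E hE hEpos (h1.symm.trans h2))
  have h0 := (prob_compl_eq_zero_iff (MeasurableSet.iUnion hm)).mpr hU
  filter_upwards [mem_ae_iff.mpr h0] with ω hω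
  simpa using hω

theorem integral_aux {n : ℕ}
    (E : Matrix (Fin (n + 1)) (Fin (n + 1)) ℝ)
    (hE : E.transpose * E = 1) (hEpos : ∀ j, 0 < E 0 j)
    {Ω : Type*} [MeasurableSpace Ω] (μ : Measure Ω) [IsProbabilityMeasure μ]
    (τ : Ω → Fin n → ℝ) (hτm : Measurable τ)
    (hτ : ∀ j, μ {ω | τ ω = stepVec E j} = ENNReal.ofReal ((E 0 j) ^ 2))
    (f : (Fin n → ℝ) → ℝ) :
    ∫ ω, f (τ ω) ∂μ = ∑ j, (E 0 j) ^ 2 * f (stepVec E j) := by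
  have hm : ∀ j, MeasurableSet {ω | τ ω = stepVec E j} := fun j =>
    hτm (measurableSet_singleton (stepVec E j))
  have hae : (fun ω => f (τ ω)) =ᵐ[μ] fun ω =>
      ∑ j, Set.indicator {ω | τ ω = stepVec E j} (fun _ => f (stepVec E j)) ω := by
    filter_upwards [ae_range_aux E hE hEpos μ τ hτm hτ] with ω hω
    obtain ⟨m, hm⟩ := hω
    rw [Finset.sum_eq_single m]
    · simp [hm]
    · intro b _ hb
      apply Set.indicator_of_notMem
      intro h
      exact hb (stepVec_inj_aux E hE hEpos (h.symm.trans hm))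
    · simp
  rw [integral_congr_ae hae, integral_finsetSum]
  · refine Finset.sum_congr rfl fun j _ => ?_
    rw [integral_indicator_const _ (hm j), measureReal_def, hτ,
      ENNReal.toReal_ofReal (sq_nonneg _), smul_eq_mul]
  · intro j _
    exact (integrable_const _).indicator (hm j)

/-- The random variables `1, τ^1, …, τ^n` are orthonormal in `L²` and span the space of all
real-valued functions of `τ`: almost surely
`g(τ) = E[g(τ)] + ∑_{k=1}^n E[g(τ) τ^k] τ^k` for every `g : ℝ^n → ℝ`. -/
theorem orthonormal_basis_expansion {n : ℕ} (hn : 1 ≤ n)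
    (E : Matrix (Fin (n + 1)) (Fin (n + 1)) ℝ)
    (hE : E.transpose * E = 1) (hEpos : ∀ j, 0 < E 0 j)
    {Ω : Type*} [MeasurableSpace Ω] (μ : Measure Ω) [IsProbabilityMeasure μ]
    (τ : Ω → Fin n → ℝ) (hτm : Measurable τ)
    (hτ : ∀ j, μ {ω | τ ω = stepVec E j} = ENNReal.ofReal ((E 0 j) ^ 2)) :
    (∀ i : Fin n, ∫ ω, τ ω i ∂μ = 0) ∧
      (∀ i j : Fin n, ∫ ω, τ ω i * τ ω j ∂μ = if i = j then 1 else 0) ∧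
      (∫ _ω, (1 : ℝ) ∂μ = 1) ∧
      ∀ g : (Fin n → ℝ) → ℝ,
        ∀ᵐ ω ∂μ, g (τ ω) =
          (∫ ω', g (τ ω') ∂μ) + ∑ k : Fin n, (∫ ω', g (τ ω') * τ ω' k ∂μ) * τ ω k := by
  have hI := integral_aux E hE hEpos μ τ hτm hτ
  have hne : ∀ j, E 0 j ≠ 0 := fun j => (hEpos j).ne'
  refine ⟨fun i => ?_, fun i j => ?_, by simp, fun g => ?_⟩
  · rw [hI (fun x => x i)]
    have h := rows_aux E hE 0 i.succ
    rw [if_neg (Fin.succ_ne_zero i).symm] at h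
    rw [← h]
    refine Finset.sum_congr rfl fun j _ => ?_
    have := hne j
    simp only [stepVec]
    field_simp
  · rw [hI (fun x => x i * x j)]
    have h := rows_aux E hE i.succ j.succ
    simp only [Fin.succ_inj] at h
    rw [← h]
    refine Finset.sum_congr rfl fun j _ => ?_
    have := hne j
    simp only [stepVec]
    field_simp
  · filter_upwards [ae_range_aux E hE hEpos μ τ hτm hτ] with ω hω
    obtain ⟨m, hm⟩ := hω
    rw [hm, hI g]
    have h1 : ∀ k, ∫ ω', g (τ ω') * τ ω' k ∂μ = _ := fun k => hI (fun x => g x * x k)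
    simp only [h1, Finset.sum_mul]
    rw [Finset.sum_comm, ← Finset.sum_add_distrib]
    have hcol : ∀ j, ∑ i, E i j * E i m = if j = m then 1 else 0 := by
      intro j
      have h := congrFun (congrFun hE j) m
      rw [Matrix.mul_apply, Matrix.one_apply] at h
      simpa only [Matrix.transpose_apply] using h
    have h2 : ∀ j, (E 0 j) ^ 2 * g (stepVec E j) +
        ∑ k, (E 0 j) ^ 2 * (g (stepVec E j) * stepVec E j k) * stepVec E m k =
        E 0 j * g (stepVec E j) / E 0 m * (if j = m then 1 else 0) := by
      intro j
      have hj := hne j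
      have hm' := hne m
      rw [← hcol j, Fin.sum_univ_succ, mul_add, Finset.mul_sum]
      congr 1
      · field_simp
      · refine Finset.sum_congr rfl fun k _ => ?_
        simp only [stepVec]
        field_simp
    rw [Finset.sum_congr rfl fun j _ => h2 j]
    have := hne m
    simp
    field_simp
end

section
/- (Consistency, uniform of order N^{-1/2}.) Fix t, let U ⊆ ℝ^n be open and suppose f(t,·) is three times continuously differentiable on U. Then for every compact subset K ⊆ U there exist a constant C_K > 0, depending only on f(t,·), and an integer N_0 such that for every N ≥ N_0 and every x ∈ K: max_{1≤j≤n} |∂^N_j f(t,·)(x) − ∂f/∂x_j(t,x)| + |Δ^N f(t,·)(x) − Δf(t,x)| ≤ C_K N^{-1/2}. -/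
/-- The discrete partial derivative `∂^N_k`. -/
noncomputable def dpartial {n : ℕ} (E : Matrix (Fin (n + 1)) (Fin (n + 1)) ℝ) (N : ℕ)
    (k : Fin n) (f : (Fin n → ℝ) → ℝ) (x : Fin n → ℝ) : ℝ :=
  Real.sqrt N * ∑ j : Fin (n + 1),
    f (x + (Real.sqrt N)⁻¹ • stepVec E j) * (E 0 j * E k.succ j)

/-- The discrete Laplacian `Δ^N`. -/
noncomputable def dlap {n : ℕ} (E : Matrix (Fin (n + 1)) (Fin (n + 1)) ℝ) (N : ℕ)
    (f : (Fin n → ℝ) → ℝ) (x : Fin n → ℝ) : ℝ :=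
  2 * N * ∑ j : Fin (n + 1),
    (f (x + (Real.sqrt N)⁻¹ • stepVec E j) - f x) * (E 0 j) ^ 2

/-- The Laplacian on `ℝ^n`. -/
noncomputable def lap {n : ℕ} (f : (Fin n → ℝ) → ℝ) (x : Fin n → ℝ) : ℝ :=
  ∑ i : Fin n, fderiv ℝ (fun y => fderiv ℝ f y (Pi.single i 1)) x (Pi.single i 1)

open Set Metric in
lemma lip_aux {V W : Type*} [NormedAddCommGroup V] [NormedSpace ℝ V]
    [NormedAddCommGroup W] [NormedSpace ℝ W] (U : Set V) (hU : IsOpen U) (g : V → W)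
    (hg : ContDiffOn ℝ 1 g U) (T : Set V) (hT : IsCompact T) (hTU : T ⊆ U) :
    ∃ M, ∀ x r, closedBall x r ⊆ T → 0 ≤ r → ∀ y ∈ closedBall x r,
      ‖g y - g x‖ ≤ M * ‖y - x‖ := by
  have h3 : ContDiffOn ℝ 0 (fderiv ℝ g) U := hg.fderiv_of_isOpen hU (by norm_num)
  obtain ⟨M, hM⟩ := hT.exists_bound_of_continuousOn (h3.continuousOn.mono hTU)
  refine ⟨M, fun x r hB hr y hy => ?_⟩
  exact (convex_closedBall x r).norm_image_sub_le_of_norm_hasFDerivWithin_le (C := M)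
      (fun z hz => ((hg.differentiableOn (by norm_num)).differentiableAt
        (hU.mem_nhds (hTU (hB hz)))).hasFDerivAt.hasFDerivWithinAt)
      (fun z hz => hM z (hB hz)) (mem_closedBall_self hr) hy

open Set Metric in
/-- Uniform Taylor expansion. -/
lemma taylor_unif {V : Type*} [NormedAddCommGroup V] [NormedSpace ℝ V] [ProperSpace V] (U : Set V) (hU : IsOpen U) (f : V → ℝ)
    (hf : ContDiffOn ℝ 3 f U) (K : Set V) (hK : IsCompact K) (hKU : K ⊆ U) :
    ∃ δ > 0, ∃ M ≥ 0, ∀ x ∈ K, ∀ v : V, ‖v‖ ≤ δ →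
      |f (x + v) - f x - fderiv ℝ f x v| ≤ M * ‖v‖ ^ 2 ∧
      |f (x + v) - f x - fderiv ℝ f x v - 1 / 2 * fderiv ℝ (fderiv ℝ f) x v v| ≤ M * ‖v‖ ^ 3 := by
  obtain ⟨δ, hδ, hδU⟩ := hK.exists_cthickening_subset_open hU hKU
  have hc : IsCompact (cthickening δ K) := hK.cthickening
  have h1 : ContDiffOn ℝ 2 (fderiv ℝ f) U := hf.fderiv_of_isOpen hU (by norm_num)
  have h2 : ContDiffOn ℝ 1 (fderiv ℝ (fderiv ℝ f)) U := h1.fderiv_of_isOpen hU (by norm_num)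
  obtain ⟨M3, hM3⟩ := lip_aux U hU _ h2 _ hc hδU
  obtain ⟨M2, hM2⟩ := lip_aux U hU _ (h1.of_le (by norm_num)) _ hc hδU
  set M := max (max M2 M3) 0 with hM
  have hM0 : 0 ≤ M := le_max_right _ _
  have hd0 : ∀ y ∈ U, HasFDerivAt f (fderiv ℝ f y) y := fun y hy =>
    ((hf.differentiableOn (by norm_num)).differentiableAt (hU.mem_nhds hy)).hasFDerivAt
  have hd1 : ∀ y ∈ U, HasFDerivAt (fderiv ℝ f) (fderiv ℝ (fderiv ℝ f) y) y := fun y hy =>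
    ((h1.differentiableOn (by norm_num)).differentiableAt (hU.mem_nhds hy)).hasFDerivAt
  refine ⟨δ, hδ, M, hM0, fun x hx v hv => ?_⟩
  have hB : closedBall x ‖v‖ ⊆ cthickening δ K :=
    (closedBall_subset_closedBall hv).trans (closedBall_subset_cthickening hx δ)
  have hBU := hB.trans hδU
  have hxB : x ∈ closedBall x ‖v‖ := mem_closedBall_self (norm_nonneg _)
  have hvB : x + v ∈ closedBall x ‖v‖ := by simp
  have hconv : Convex ℝ (closedBall x ‖v‖) := convex_closedBall _ _
  have hsymm : IsSymmSndFDerivAt ℝ f x :=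
    (hf.contDiffAt (hU.mem_nhds (hKU hx))).isSymmSndFDerivAt (by simp; norm_num)
  have hn : ∀ y ∈ closedBall x ‖v‖, ‖y - x‖ ≤ ‖v‖ := fun y hy => by
    simpa [dist_eq_norm] using hy
  -- Lipschitz bounds
  have l1 : ∀ y ∈ closedBall x ‖v‖, ‖fderiv ℝ f y - fderiv ℝ f x‖ ≤ M * ‖v‖ := fun y hy =>
    (hM2 x _ hB (norm_nonneg _) y hy).trans
      (mul_le_mul ((le_max_left _ _).trans (le_max_left _ _)) (hn y hy) (norm_nonneg _) hM0)
  have l2 : ∀ y ∈ closedBall x ‖v‖,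
      ‖fderiv ℝ (fderiv ℝ f) y - fderiv ℝ (fderiv ℝ f) x‖ ≤ M * ‖v‖ := fun y hy =>
    (hM3 x _ hB (norm_nonneg _) y hy).trans
      (mul_le_mul ((le_max_right _ _).trans (le_max_left _ _)) (hn y hy) (norm_nonneg _) hM0)
  have l3 : ∀ y ∈ closedBall x ‖v‖,
      ‖fderiv ℝ f y - fderiv ℝ f x - fderiv ℝ (fderiv ℝ f) x (y - x)‖ ≤ M * ‖v‖ * ‖v‖ :=
    fun y hy =>
    (hconv.norm_image_sub_le_of_norm_hasFDerivWithin_le' (C := M * ‖v‖)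
      (fun z hz => (hd1 z (hBU hz)).hasFDerivWithinAt) l2 hxB hy).trans
      (mul_le_mul_of_nonneg_left (hn y hy) (by positivity))
  constructor
  · have := hconv.norm_image_sub_le_of_norm_hasFDerivWithin_le' (C := M * ‖v‖)
      (fun z hz => (hd0 z (hBU hz)).hasFDerivWithinAt) l1 hxB hvB
    simp only [add_sub_cancel_left, Real.norm_eq_abs] at this
    calc _ ≤ _ := this
      _ = _ := by ring
  · have hq : ∀ z : V, HasFDerivAt
        (fun y => 1 / 2 * fderiv ℝ (fderiv ℝ f) x (y - x) (y - x))
        (fderiv ℝ (fderiv ℝ f) x (z - x)) z := by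
      intro z
      have a : HasFDerivAt (fun y : V => y - x) (ContinuousLinearMap.id ℝ _) z :=
        (hasFDerivAt_id z).sub_const x
      have b := ((fderiv ℝ (fderiv ℝ f) x).hasFDerivAt.comp z a)
      have c := (b.clm_apply a).const_mul (1 / 2 : ℝ)
      refine c.congr_fderiv ?_
      ext w
      have := hsymm.eq w (z - x)
      simp [-Pi.sub_apply, -map_sub] 
      rw [this]
      ring
    have := hconv.norm_image_sub_le_of_norm_hasFDerivWithin_le' (C := M * ‖v‖ * ‖v‖)
      (f := fun y => f y - 1 / 2 * fderiv ℝ (fderiv ℝ f) x (y - x) (y - x))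
      (f' := fun y => fderiv ℝ f y - fderiv ℝ (fderiv ℝ f) x (y - x)) (φ := fderiv ℝ f x)
      (fun z hz => ((hd0 z (hBU hz)).sub (hq z)).hasFDerivWithinAt)
      (fun z hz => by rw [sub_right_comm]; exact l3 z hz) hxB hvB
    simp only [add_sub_cancel_left, Real.norm_eq_abs, sub_self, map_zero, mul_zero, sub_zero] at this
    calc _ = _ := by congr 1; ring
      _ ≤ _ := this
      _ = _ := by ring

lemma clm_expand {n : ℕ} {G : Type*} [NormedAddCommGroup G] [NormedSpace ℝ G]
    (A : (Fin n → ℝ) →L[ℝ] G) (v : Fin n → ℝ) :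
    A v = ∑ i, v i • A (Pi.single i 1) := by
  conv_lhs => rw [pi_eq_sum_univ' v]
  simp only [map_sum, map_smul]

section
variable {n : ℕ} (E : Matrix (Fin (n + 1)) (Fin (n + 1)) ℝ)

lemma E_row (hE : E.transpose * E = 1) (a b : Fin (n + 1)) :
    ∑ j, E a j * E b j = if a = b then 1 else 0 := by
  have h : E * E.transpose = 1 := mul_eq_one_comm.mp hE
  have := congrFun (congrFun h a) b
  simpa [Matrix.mul_apply, Matrix.one_apply] using this

lemma id1 (hE : E.transpose * E = 1) (hEpos : ∀ j, 0 < E 0 j)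
    (A : (Fin n → ℝ) →L[ℝ] ℝ) (k : Fin (n + 1)) :
    ∑ j, A (stepVec E j) * (E 0 j * E k j) =
      ∑ i : Fin n, if i.succ = k then A (Pi.single i 1) else 0 := by
  have : ∀ j, A (stepVec E j) * (E 0 j * E k j) =
      ∑ i : Fin n, (E i.succ j * E k j) * A (Pi.single i 1) := by
    intro j
    rw [clm_expand A, Finset.sum_mul]
    refine Finset.sum_congr rfl fun i _ => ?_
    have := (hEpos j).ne'
    simp only [stepVec, smul_eq_mul]
    field_simp
  simp_rw [this]
  rw [Finset.sum_comm]
  refine Finset.sum_congr rfl fun i _ => ?_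
  rw [← Finset.sum_mul, E_row E hE]
  simp

lemma id2 (hE : E.transpose * E = 1) (hEpos : ∀ j, 0 < E 0 j)
    (B : (Fin n → ℝ) →L[ℝ] (Fin n → ℝ) →L[ℝ] ℝ) :
    ∑ j, B (stepVec E j) (stepVec E j) * E 0 j ^ 2 =
      ∑ i : Fin n, B (Pi.single i 1) (Pi.single i 1) := by
  have : ∀ j, B (stepVec E j) (stepVec E j) * E 0 j ^ 2 =
      ∑ i : Fin n, B (Pi.single i 1) (stepVec E j) * (E 0 j * E i.succ j) := by
    intro j
    rw [clm_expand B, sum_apply, Finset.sum_mul]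
    refine Finset.sum_congr rfl fun i _ => ?_
    have := (hEpos j).ne'
    rw [_root_.smul_apply, smul_eq_mul]
    have e : stepVec E j i = E i.succ j / E 0 j := rfl
    rw [e]
    field_simp
  simp_rw [this]
  rw [Finset.sum_comm]
  refine Finset.sum_congr rfl fun i _ => ?_
  rw [id1 E hE hEpos]
  simp
end

/-- Uniform consistency of order `N^{-1/2}`: if `f` (a fixed time slice) is `C³` on an open set
`U`, then on every compact `K ⊆ U`,
`max_j |∂^N_j f − ∂f/∂x_j| + |Δ^N f − Δf| ≤ C_K N^{-1/2}` for all large `N`. -/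
theorem discrete_operators_consistency_order {n : ℕ} (hn : 1 ≤ n)
    (E : Matrix (Fin (n + 1)) (Fin (n + 1)) ℝ)
    (hE : E.transpose * E = 1) (hEpos : ∀ j, 0 < E 0 j)
    (U : Set (Fin n → ℝ)) (hU : IsOpen U) (f : (Fin n → ℝ) → ℝ)
    (hf : ContDiffOn ℝ 3 f U) (K : Set (Fin n → ℝ)) (hK : IsCompact K) (hKU : K ⊆ U) :
    ∃ C > 0, ∃ N₀ : ℕ, ∀ N ≥ N₀, ∀ x ∈ K, ∀ j : Fin n,
      |dpartial E N j f x - fderiv ℝ f x (Pi.single j 1)| + |dlap E N f x - lap f x|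
        ≤ C / Real.sqrt N := by
  obtain ⟨δ, hδ, M, hM, hT⟩ := taylor_unif U hU f hf K hK hKU
  set C1 := ∑ k : Fin n, ∑ j, M * ‖stepVec E j‖ ^ 2 * |E 0 j * E k.succ j| with hC1
  set C2 := 2 * ∑ j, M * ‖stepVec E j‖ ^ 3 * E 0 j ^ 2 with hC2
  have hC1' : 0 ≤ C1 := by positivity
  have hC2' : 0 ≤ C2 := by positivity
  set S := ∑ j, ‖stepVec E j‖ with hS
  obtain ⟨N₀, hN₀⟩ := exists_nat_gt ((S / δ) ^ 2)
  refine ⟨C1 + C2 + 1, by positivity, N₀ + 1, fun N hN x hx k => ?_⟩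
  have hNpos : (0 : ℝ) < N := by exact_mod_cast (by omega : 0 < N)
  have hs : 0 < Real.sqrt N := Real.sqrt_pos.2 hNpos
  have hss : Real.sqrt N * Real.sqrt N = N := Real.mul_self_sqrt hNpos.le
  have hsS : S / δ ≤ Real.sqrt N := by
    apply Real.le_sqrt_of_sq_le
    have : (N₀ : ℝ) ≤ N := by exact_mod_cast (by omega : N₀ ≤ N)
    linarith
  set s := Real.sqrt N with hsdef
  have hnorm : ∀ j, ‖s⁻¹ • stepVec E j‖ = s⁻¹ * ‖stepVec E j‖ := fun j => by
    rw [norm_smul, Real.norm_of_nonneg (inv_nonneg.2 hs.le)]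
  have hle : ∀ j, ‖s⁻¹ • stepVec E j‖ ≤ δ := fun j => by
    rw [hnorm, inv_mul_le_iff₀ hs]
    have h1 : ‖stepVec E j‖ ≤ S :=
      Finset.single_le_sum (f := fun j => ‖stepVec E j‖) (fun i _ => norm_nonneg _)
        (Finset.mem_univ j)
    rw [div_le_iff₀ hδ] at hsS
    linarith
  set A := fderiv ℝ f x with hA
  set B := fderiv ℝ (fderiv ℝ f) x with hB
  have hlap : lap f x = ∑ i : Fin n, B (Pi.single i 1) (Pi.single i 1) := by
    unfold lap
    refine Finset.sum_congr rfl fun i _ => ?_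
    have hd : DifferentiableAt ℝ (fderiv ℝ f) x :=
      (((hf.fderiv_of_isOpen hU (m := 2) (by norm_num)).differentiableOn
        (by norm_num)).differentiableAt (hU.mem_nhds (hKU hx)))
    have := (hd.hasFDerivAt.clm_apply (hasFDerivAt_const (Pi.single i (1 : ℝ)) x)).fderiv
    rw [this]
    simp [hB]
  have p1 : dpartial E N k f x - A (Pi.single k 1) = s * ∑ j,
      (f (x + s⁻¹ • stepVec E j) - f x - A (s⁻¹ • stepVec E j)) * (E 0 j * E k.succ j) := by
    have e0 := E_row E hE 0 k.succ
    have e1 := id1 E hE hEpos A k.succ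
    rw [if_neg (Fin.succ_ne_zero k).symm] at e0
    simp only [Fin.succ_inj, Finset.sum_ite_eq', Finset.mem_univ, if_true] at e1
    simp only [sub_mul, Finset.sum_sub_distrib, map_smul, smul_eq_mul, mul_assoc]
    rw [← Finset.mul_sum, ← Finset.mul_sum, e0, e1]
    simp only [dpartial, ← hsdef]
    field_simp
    ring
  have p2 : dlap E N f x - lap f x = 2 * N * ∑ j,
      (f (x + s⁻¹ • stepVec E j) - f x - A (s⁻¹ • stepVec E j)
        - 1 / 2 * B (s⁻¹ • stepVec E j) (s⁻¹ • stepVec E j)) * E 0 j ^ 2 := by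
    have e1 := id1 E hE hEpos A 0
    simp only [Fin.succ_ne_zero, if_false, Finset.sum_const_zero, ← pow_two] at e1
    have e2 := id2 E hE hEpos B
    rw [hlap, ← e2]
    have q1 : ∑ j, A (s⁻¹ • stepVec E j) * E 0 j ^ 2 = 0 := by
      simp only [map_smul, smul_eq_mul, mul_assoc]
      rw [← Finset.mul_sum, e1, mul_zero]
    have q2 : ∑ j, 1 / 2 * B (s⁻¹ • stepVec E j) (s⁻¹ • stepVec E j) * E 0 j ^ 2 =
        1 / (2 * N) * ∑ j, B (stepVec E j) (stepVec E j) * E 0 j ^ 2 := by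
      rw [Finset.mul_sum]
      refine Finset.sum_congr rfl fun j _ => ?_
      simp only [map_smul, smul_eq_mul, _root_.smul_apply]
      rw [← hss]
      field_simp
    simp only [dlap, ← hsdef]
    rw [Finset.sum_congr rfl (fun j _ => sub_mul (f (x + s⁻¹ • stepVec E j) - f x - A (s⁻¹ • stepVec E j)) (1 / 2 * B (s⁻¹ • stepVec E j) (s⁻¹ • stepVec E j)) (E 0 j ^ 2)),
      Finset.sum_sub_distrib, q2,
      Finset.sum_congr rfl (fun j _ => sub_mul (f (x + s⁻¹ • stepVec E j) - f x) (A (s⁻¹ • stepVec E j)) (E 0 j ^ 2)),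
      Finset.sum_sub_distrib, q1]
    field_simp
    ring
  have b1 : |dpartial E N k f x - A (Pi.single k 1)| ≤ C1 / s := by
    rw [p1, abs_mul, abs_of_pos hs]
    have : |∑ j, (f (x + s⁻¹ • stepVec E j) - f x - A (s⁻¹ • stepVec E j)) *
        (E 0 j * E k.succ j)| ≤
        (s⁻¹) ^ 2 * ∑ j, M * ‖stepVec E j‖ ^ 2 * |E 0 j * E k.succ j| := by
      refine (Finset.abs_sum_le_sum_abs _ _).trans ?_
      rw [Finset.mul_sum]
      refine Finset.sum_le_sum fun j _ => ?_
      rw [abs_mul]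
      have h := (hT x hx _ (hle j)).1
      rw [hnorm] at h
      calc _ ≤ _ := mul_le_mul_of_nonneg_right h (abs_nonneg _)
        _ = _ := by ring
    have h2 : ∑ j, M * ‖stepVec E j‖ ^ 2 * |E 0 j * E k.succ j| ≤ C1 :=
      Finset.single_le_sum
        (f := fun k : Fin n => ∑ j, M * ‖stepVec E j‖ ^ 2 * |E 0 j * E k.succ j|)
        (fun i _ => by positivity) (Finset.mem_univ k)
    calc _ ≤ s * ((s⁻¹) ^ 2 * C1) := by gcongr; exact this.trans (by gcongr)
      _ = _ := by field_simp
  have b2 : |dlap E N f x - lap f x| ≤ C2 / s := by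
    rw [p2, abs_mul, abs_of_pos (by positivity : (0 : ℝ) < 2 * N)]
    have : |∑ j, (f (x + s⁻¹ • stepVec E j) - f x - A (s⁻¹ • stepVec E j)
        - 1 / 2 * B (s⁻¹ • stepVec E j) (s⁻¹ • stepVec E j)) * E 0 j ^ 2| ≤
        (s⁻¹) ^ 3 * ∑ j, M * ‖stepVec E j‖ ^ 3 * E 0 j ^ 2 := by
      refine (Finset.abs_sum_le_sum_abs _ _).trans ?_
      rw [Finset.mul_sum]
      refine Finset.sum_le_sum fun j _ => ?_
      rw [abs_mul, abs_of_nonneg (sq_nonneg (E 0 j))]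
      have h := (hT x hx _ (hle j)).2
      rw [hnorm] at h
      calc _ ≤ _ := mul_le_mul_of_nonneg_right h (sq_nonneg _)
        _ = _ := by ring
    calc _ ≤ 2 * N * ((s⁻¹) ^ 3 * ∑ j, M * ‖stepVec E j‖ ^ 3 * E 0 j ^ 2) := by gcongr
      _ = _ := by rw [hC2, ← hss]; field_simp
  calc _ ≤ C1 / s + C2 / s := add_le_add b1 b2
    _ = (C1 + C2) / s := by ring
    _ ≤ _ := div_le_div_of_nonneg_right (by linarith) hs.le
end

section
/- (Non-vanishing third moments in dimension ≥ 2.) Let n ≥ 2 and let τ = (τ^1,…,τ^n) be a random variable defined on a probability space with exactly n+1 atoms, each of strictly positive probability, such that E[τ^i] = 0 and E[τ^i τ^j] = δ_{ij} for all i, j ∈ {1,…,n}. Then there exist i, j, k ∈ {1,…,n} such that E[τ^i τ^j τ^k] ≠ 0. -/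
/-- Non-vanishing third moments in dimension `n ≥ 2`: if `τ` is supported on `n+1` atoms of
positive probability `p_l`, has mean zero and identity covariance, then some third moment
`E[τ^i τ^j τ^k] = ∑_l p_l τ_l^i τ_l^j τ_l^k` is nonzero. -/
theorem third_moment_ne_zero {n : ℕ} (hn : 2 ≤ n)
    (p : Fin (n + 1) → ℝ) (hp : ∀ l, 0 < p l) (hpsum : ∑ l, p l = 1)
    (τ : Fin (n + 1) → Fin n → ℝ)
    (hmean : ∀ i : Fin n, ∑ l, p l * τ l i = 0)
    (hcov : ∀ i j : Fin n, ∑ l, p l * (τ l i * τ l j) = if i = j then 1 else 0) :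
    ∃ i j k : Fin n, ∑ l, p l * (τ l i * τ l j * τ l k) ≠ 0 := by
  by_contra hcon
  push Not at hcon
  let B : Matrix (Fin (n + 1)) (Fin (n + 1)) ℝ := fun l => Fin.cons 1 (τ l)
  let C : Matrix (Fin (n + 1)) (Fin (n + 1)) ℝ := fun i l => p l * B l i
  have hCB : C * B = 1 := by
    ext i j
    rw [Matrix.mul_apply, Matrix.one_apply]
    refine Fin.cases ?_ (fun i => ?_) i <;> refine Fin.cases ?_ (fun j => ?_) j
    · simpa [C, B] using hpsum
    · simpa [C, B, (Fin.succ_ne_zero j).symm] using hmean j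
    · simpa [C, B] using hmean i
    · simpa [C, B, mul_assoc] using hcov i j
  have hBC : B * C = 1 := mul_eq_one_comm.mp hCB
  have hG : ∀ l m, p m * (1 + ∑ i, τ l i * τ m i) = if l = m then 1 else 0 := by
    intro l m
    have h := congrFun (congrFun hBC l) m
    rw [Matrix.mul_apply, Matrix.one_apply, Fin.sum_univ_succ] at h
    rw [← h, mul_add, Finset.mul_sum]
    simp only [C, B, Fin.cons_zero, Fin.cons_succ]
    congr 1
    · ring
    · exact Finset.sum_congr rfl fun i _ => by ring
  have hcube : ∀ a, ∑ l, p l * (∑ i, τ l i * τ a i) ^ 3 = 0 := by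
    intro a
    have h1 : ∀ l, p l * (∑ i, τ l i * τ a i) ^ 3
        = ∑ i, ∑ j, ∑ k, (τ a i * τ a j * τ a k) * (p l * (τ l i * τ l j * τ l k)) := by
      intro l
      rw [pow_succ, pow_two, Finset.sum_mul_sum, Finset.sum_mul, Finset.mul_sum]
      refine Finset.sum_congr rfl fun i _ => ?_
      rw [Finset.sum_mul, Finset.mul_sum]
      refine Finset.sum_congr rfl fun j _ => ?_
      rw [Finset.mul_sum, Finset.mul_sum]
      exact Finset.sum_congr rfl fun k _ => by ring
    simp_rw [h1]
    rw [Finset.sum_comm]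
    refine Finset.sum_eq_zero fun i _ => ?_
    rw [Finset.sum_comm]
    refine Finset.sum_eq_zero fun j _ => ?_
    rw [Finset.sum_comm]
    refine Finset.sum_eq_zero fun k _ => ?_
    rw [← Finset.mul_sum, hcon, mul_zero]
  have hhalf : ∀ a, p a = 1 / 2 := by
    intro a
    have hne : ∀ l, l ≠ a → (∑ i, τ l i * τ a i) = -1 := by
      intro l hl
      have h := hG l a
      rw [if_neg hl] at h
      have := (mul_eq_zero.mp h).resolve_left (hp a).ne'
      linarith
    have haa := hG a a
    rw [if_pos rfl] at haa
    have hc := hcube a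
    have hs := hpsum
    rw [← Finset.add_sum_erase _ _ (Finset.mem_univ a)] at hc hs
    have h2 : ∑ l ∈ Finset.univ.erase a, p l * (∑ i, τ l i * τ a i) ^ 3
        = - ∑ l ∈ Finset.univ.erase a, p l := by
      rw [← Finset.sum_neg_distrib]
      refine Finset.sum_congr rfl fun l hl => ?_
      rw [hne l (Finset.ne_of_mem_erase hl)]
      ring
    rw [h2] at hc
    have hpos : 0 < ∑ l ∈ Finset.univ.erase a, p l := by
      refine Finset.sum_pos (fun l _ => hp l) ?_
      rw [← Finset.card_pos, Finset.card_erase_of_mem (Finset.mem_univ a)]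
      simp
      omega
    generalize (∑ l ∈ Finset.univ.erase a, p l) = S at *
    generalize (∑ i, τ a i * τ a i) = g at *
    have hS : p a * g = S := by linarith
    have hg : 0 < g := by
      by_contra hg
      nlinarith [hp a]
    have h3 : S * ((g - 1) * (g + 1)) = 0 := by
      rw [← hS] at hc ⊢
      linear_combination hc
    have h4 := (mul_eq_zero.mp h3).resolve_left hpos.ne'
    have h5 := (mul_eq_zero.mp h4).resolve_right (by linarith)
    have h6 : g = 1 := by linarith
    rw [h6] at haa
    linarith
  simp only [hhalf] at hpsum
  simp at hpsum
  have : (2 : ℝ) ≤ n := by exact_mod_cast hn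
  linarith
end

section
/- (Sharpness of the order N^{-1/2} for n ≥ 2.) Let n ≥ 2. Then there exist indices i, j, k ∈ {1,…,n} and a nonzero real constant c such that, for the cubic monomial f(x) = x_i x_j x_k, one has √N (Δ^N f(x) − Δf(x)) = c for every integer N ≥ 1 and every x ∈ ℝ^n; in particular, the consistency order N^{-1/2} of Δ^N cannot be improved for general smooth f when n ≥ 2. -/
theorem fd_mono {n : ℕ} (i j k : Fin n) (y v : Fin n → ℝ) :
    fderiv ℝ (fun y : Fin n → ℝ => y i * y j * y k) y v
      = v i * y j * y k + y i * v j * y k + y i * y j * v k := by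
  have h (a : Fin n) : HasFDerivAt (fun y : Fin n → ℝ => y a)
      (ContinuousLinearMap.proj (R := ℝ) (φ := fun _ : Fin n => ℝ) a) y := hasFDerivAt_apply a y
  rw [(((h i).fun_mul (h j)).fun_mul (h k)).fderiv]
  simp
  ring

theorem fd_mono2 {n : ℕ} (i j k : Fin n) (y v : Fin n → ℝ) :
    fderiv ℝ (fun y : Fin n → ℝ => v i * y j * y k + y i * v j * y k + y i * y j * v k) y v
      = 2 * (v i * v j * y k + v i * v k * y j + v j * v k * y i) := by
  have h (a : Fin n) : HasFDerivAt (fun y : Fin n → ℝ => y a)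
      (ContinuousLinearMap.proj (R := ℝ) (φ := fun _ : Fin n => ℝ) a) y := hasFDerivAt_apply a y
  rw [((((h j).const_mul (v i)).fun_mul (h k)).fun_add (((h i).mul_const (v j)).fun_mul (h k))
    |>.fun_add (((h i).fun_mul (h j)).mul_const (v k))).fderiv]
  simp
  ring

theorem lap_mono {n : ℕ} (i j k : Fin n) (x : Fin n → ℝ) :
    lap (fun y : Fin n → ℝ => y i * y j * y k) x
      = 2 * ((if i = j then 1 else 0) * x k + (if i = k then 1 else 0) * x j
        + (if j = k then 1 else 0) * x i) := by
  have hs (a b : Fin n) : ∑ l : Fin n, (Pi.single l 1 : Fin n → ℝ) a * (Pi.single l 1 : Fin n → ℝ) b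
      = if a = b then 1 else 0 := by
    simp [Pi.single_apply]
  unfold lap
  simp only [fd_mono, fd_mono2]
  rw [← Finset.mul_sum, Finset.sum_add_distrib, Finset.sum_add_distrib, ← Finset.sum_mul,
    ← Finset.sum_mul, ← Finset.sum_mul, hs, hs, hs]

theorem dlap_mono {n : ℕ} (E : Matrix (Fin (n + 1)) (Fin (n + 1)) ℝ)
    (hE : E.transpose * E = 1) (hEpos : ∀ j, 0 < E 0 j) (i j k : Fin n) (N : ℕ) (hN : 1 ≤ N)
    (x : Fin n → ℝ) :
    Real.sqrt N * (dlap E N (fun y => y i * y j * y k) x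
            - lap (fun y => y i * y j * y k) x)
      = 2 * ∑ m, stepVec E m i * stepVec E m j * stepVec E m k * (E 0 m) ^ 2 := by
  have hE' : E * E.transpose = 1 := mul_eq_one_comm.mp hE
  have hr (a b : Fin (n+1)) : ∑ m, E a m * E b m = if a = b then 1 else 0 := by
    have := congrFun (congrFun hE' a) b
    simpa [Matrix.mul_apply, Matrix.one_apply] using this
  have h1 (a : Fin n) : ∑ m, stepVec E m a * (E 0 m) ^ 2 = 0 := by
    have := hr a.succ 0
    rw [if_neg (Fin.succ_ne_zero a)] at this
    rw [← this]
    refine Finset.sum_congr rfl fun m _ => ?_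
    have := (hEpos m).ne'
    unfold stepVec
    field_simp
  have h2 (a b : Fin n) : ∑ m, stepVec E m a * stepVec E m b * (E 0 m) ^ 2
      = if a = b then 1 else 0 := by
    have := hr a.succ b.succ
    simp only [Fin.succ_inj] at this
    rw [← this]
    refine Finset.sum_congr rfl fun m _ => ?_
    have := (hEpos m).ne'
    unfold stepVec
    field_simp
  rw [lap_mono, ← h2, ← h2, ← h2]
  unfold dlap
  have hs : 0 < Real.sqrt N := Real.sqrt_pos.mpr (by exact_mod_cast hN)
  have hsq : (N : ℝ) = Real.sqrt N ^ 2 := (Real.sq_sqrt (by positivity)).symm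
  set s := Real.sqrt N
  rw [hsq]
  have key : ∑ m, (((x + s⁻¹ • stepVec E m) i * (x + s⁻¹ • stepVec E m) j
        * (x + s⁻¹ • stepVec E m) k) - x i * x j * x k) * (E 0 m) ^ 2
      = s⁻¹ * (x i * x j * ∑ m, stepVec E m k * (E 0 m) ^ 2
          + x i * x k * ∑ m, stepVec E m j * (E 0 m) ^ 2
          + x j * x k * ∑ m, stepVec E m i * (E 0 m) ^ 2)
        + s⁻¹ ^ 2 * ((∑ m, stepVec E m i * stepVec E m j * (E 0 m) ^ 2) * x k
          + (∑ m, stepVec E m i * stepVec E m k * (E 0 m) ^ 2) * x j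
          + (∑ m, stepVec E m j * stepVec E m k * (E 0 m) ^ 2) * x i)
        + s⁻¹ ^ 3 * ∑ m, stepVec E m i * stepVec E m j * stepVec E m k * (E 0 m) ^ 2 := by
    simp only [Finset.mul_sum, Finset.sum_mul, ← Finset.sum_add_distrib]
    refine Finset.sum_congr rfl fun m _ => ?_
    simp only [Pi.add_apply, Pi.smul_apply, smul_eq_mul]
    ring
  rw [key, h1, h1, h1]
  field_simp
  ring

theorem exists_third {n : ℕ} (hn : 2 ≤ n) (E : Matrix (Fin (n + 1)) (Fin (n + 1)) ℝ)
    (hE : E.transpose * E = 1) (hEpos : ∀ j, 0 < E 0 j) :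
    ∃ i j k : Fin n, ∑ m, stepVec E m i * stepVec E m j * stepVec E m k * (E 0 m) ^ 2 ≠ 0 := by
  by_contra! H
  have hE' : E * E.transpose = 1 := mul_eq_one_comm.mp hE
  have hsum : ∑ m, (E 0 m) ^ 2 = 1 := by
    have := congrFun (congrFun hE' 0) 0
    simpa [Matrix.mul_apply, Matrix.one_apply, sq] using this
  have hdot (l m : Fin (n+1)) : ∑ a, stepVec E l a * stepVec E m a
      = (if l = m then ((E 0 m) ^ 2)⁻¹ else 0) - 1 := by
    have := congrFun (congrFun hE l) m
    rw [Matrix.mul_apply, Fin.sum_univ_succ, Matrix.one_apply] at this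
    simp only [Matrix.transpose_apply] at this
    have hl := (hEpos l).ne'
    have hm := (hEpos m).ne'
    have h3 : ∑ a, stepVec E l a * stepVec E m a
        = (E 0 l)⁻¹ * (E 0 m)⁻¹ * ∑ a : Fin n, E a.succ l * E a.succ m := by
      rw [Finset.mul_sum]
      refine Finset.sum_congr rfl fun a _ => ?_
      unfold stepVec
      field_simp
    rw [h3, eq_sub_of_add_eq' this]
    split_ifs with h
    · subst h; field_simp
    · field_simp; ring
  have hzero (m : Fin (n+1)) :
      ∑ l, (∑ a, stepVec E l a * stepVec E m a) ^ 3 * (E 0 l) ^ 2 = 0 := by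
    have : ∑ l, (∑ a, stepVec E l a * stepVec E m a) ^ 3 * (E 0 l) ^ 2
        = ∑ a, ∑ b, ∑ c, stepVec E m a * stepVec E m b * stepVec E m c *
          ∑ l, stepVec E l a * stepVec E l b * stepVec E l c * (E 0 l) ^ 2 := by
      simp only [Finset.mul_sum]
      simp only [pow_three, Finset.sum_mul_sum, Finset.mul_sum, Finset.sum_mul]
      rw [Finset.sum_comm]
      refine Finset.sum_congr rfl fun a _ => ?_
      rw [Finset.sum_comm]
      refine Finset.sum_congr rfl fun b _ => ?_
      rw [Finset.sum_comm]
      refine Finset.sum_congr rfl fun c _ => ?_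
      refine Finset.sum_congr rfl fun l _ => ?_
      ring
    rw [this]
    simp [H]
  have hlt (m : Fin (n+1)) : (E 0 m) ^ 2 < 1 := by
    rw [← hsum]
    obtain ⟨l, hl⟩ : ∃ l : Fin (n+1), l ≠ m := by
      have : Nontrivial (Fin (n+1)) := Fin.nontrivial_iff_two_le.mpr (by omega)
      exact exists_ne m
    exact Finset.single_lt_sum hl (Finset.mem_univ m) (Finset.mem_univ l)
      (pow_pos (hEpos l) 2) (fun k _ _ => sq_nonneg _)
  have hhalf (m : Fin (n+1)) : (E 0 m) ^ 2 = 1 / 2 := by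
    have h := hzero m
    simp only [hdot] at h
    have h4 : ∑ l, ((if l = m then ((E 0 m) ^ 2)⁻¹ else 0) - 1) ^ 3 * (E 0 l) ^ 2
        = ∑ l, ((if l = m then ((((E 0 m) ^ 2)⁻¹ - 1) ^ 3 + 1) * (E 0 m) ^ 2 else 0)
          - (E 0 l) ^ 2) := by
      refine Finset.sum_congr rfl fun l _ => ?_
      split_ifs with h
      · subst h; ring
      · ring
    rw [h4, Finset.sum_sub_distrib, hsum, Finset.sum_ite_eq' Finset.univ m] at h
    simp only [Finset.mem_univ, if_true] at h
    have hp : 0 < (E 0 m) ^ 2 := pow_pos (hEpos m) 2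
    have hp1 := hlt m
    generalize (E 0 m) ^ 2 = p at *
    have h5 : (1 - p) * (1 - 2 * p) = 0 := by
      field_simp at h
      linear_combination h
    rcases mul_eq_zero.mp h5 with h6 | h6 <;> linarith
  simp only [hhalf, Finset.sum_const, Finset.card_univ, Fintype.card_fin, nsmul_eq_mul] at hsum
  have : (2 : ℝ) ≤ n := by exact_mod_cast hn
  push_cast at hsum
  linarith

/-- Sharpness of the order `N^{-1/2}` for `n ≥ 2`: there are indices `i, j, k` and a nonzero
constant `c` such that for the cubic monomial `f(x) = x_i x_j x_k`,
`√N (Δ^N f(x) − Δf(x)) = c` for every `N ≥ 1` and every `x`. -/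
theorem order_sharp_of_dim_ge_two {n : ℕ} (hn : 2 ≤ n)
    (E : Matrix (Fin (n + 1)) (Fin (n + 1)) ℝ)
    (hE : E.transpose * E = 1) (hEpos : ∀ j, 0 < E 0 j) :
    ∃ i j k : Fin n, ∃ c : ℝ, c ≠ 0 ∧
      ∀ N : ℕ, 1 ≤ N → ∀ x : Fin n → ℝ,
        Real.sqrt N * (dlap E N (fun y => y i * y j * y k) x
            - lap (fun y => y i * y j * y k) x) = c := by
  obtain ⟨i, j, k, h⟩ := exists_third hn E hE hEpos
  exact ⟨i, j, k, _, mul_ne_zero two_ne_zero h,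
    fun N hN x => dlap_mono E hE hEpos i j k N hN x⟩
end

section
/- The linear map L : ℝ^{n+1} → ℝ^n defined by L(c_0,…,c_n) = Σ_{j=0}^n c_j e_j is surjective and its kernel is the one-dimensional line spanned by the vector (e_{0,0}^2, e_{0,1}^2, …, e_{0,n}^2). -/
/-- The map `L(c_0,…,c_n) = ∑_j c_j e_j` is surjective onto `ℝ^n` and its kernel is the line
spanned by `(e_{0,0}², …, e_{0,n}²)`. -/
theorem stepVec_combination_surjective_kernel {n : ℕ} (hn : 1 ≤ n)
    (E : Matrix (Fin (n + 1)) (Fin (n + 1)) ℝ)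
    (hE : E.transpose * E = 1) (hEpos : ∀ j, 0 < E 0 j) :
    Function.Surjective (fun c : Fin (n + 1) → ℝ => ∑ j, c j • stepVec E j) ∧
      ∀ c : Fin (n + 1) → ℝ,
        (∑ j, c j • stepVec E j) = 0 ↔ ∃ t : ℝ, c = t • fun j => (E 0 j) ^ 2 := by
  have hE' : E * E.transpose = 1 := mul_eq_one_comm.mp hE
  have key : ∀ (c : Fin (n + 1) → ℝ) (k : Fin n),
      (∑ j, c j • stepVec E j) k = (E.mulVec (fun j => c j / E 0 j)) k.succ := by
    intro c k
    simp only [Finset.sum_apply, Pi.smul_apply, smul_eq_mul, stepVec, Matrix.mulVec, dotProduct]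
    exact Finset.sum_congr rfl fun j _ => by ring
  have hne : ∀ j, E 0 j ≠ 0 := fun j => (hEpos j).ne'
  refine ⟨fun y => ?_, fun c => ⟨fun h => ?_, ?_⟩⟩
  · refine ⟨fun j => E 0 j * (E.transpose.mulVec (Fin.cons 0 y : Fin (n + 1) → ℝ)) j, ?_⟩
    funext k
    refine (key _ k).trans ?_
    have : (fun j => E 0 j * (E.transpose.mulVec (Fin.cons 0 y : Fin (n + 1) → ℝ)) j / E 0 j)
        = E.transpose.mulVec (Fin.cons 0 y : Fin (n + 1) → ℝ) := by
      funext j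
      exact mul_div_cancel_left₀ _ (hne j)
    rw [this, Matrix.mulVec_mulVec, hE', Matrix.one_mulVec, Fin.cons_succ]
  · refine ⟨(E.mulVec (fun j => c j / E 0 j)) 0, ?_⟩
    have h1 : E.transpose.mulVec (E.mulVec (fun j => c j / E 0 j)) = fun j => c j / E 0 j := by
      rw [Matrix.mulVec_mulVec, hE, Matrix.one_mulVec]
    funext j
    have h2 := congrFun h1 j
    have h3 : ∀ k : Fin n, (E.mulVec (fun j => c j / E 0 j)) k.succ = 0 := fun k => by
      rw [← key, h]; rfl
    generalize E.mulVec (fun j => c j / E 0 j) = v at h2 h3 ⊢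
    simp only [Matrix.mulVec, dotProduct, Fin.sum_univ_succ, h3, Matrix.transpose_apply,
      mul_zero, Finset.sum_const_zero, add_zero] at h2
    rw [eq_div_iff (hne j)] at h2
    simp only [Pi.smul_apply, smul_eq_mul]
    rw [← h2]; ring
  · rintro ⟨t, rfl⟩
    funext k
    rw [key]
    have h4 := congrFun (congrFun hE' k.succ) 0
    rw [Matrix.one_apply_ne (Fin.succ_ne_zero k)] at h4
    simp only [Matrix.mul_apply, Matrix.transpose_apply] at h4
    simp only [Matrix.mulVec, dotProduct, Pi.smul_apply, smul_eq_mul, Pi.zero_apply]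
    rw [← mul_zero t, ← h4, Finset.mul_sum]
    refine Finset.sum_congr rfl fun j _ => ?_
    have := hne j
    field_simp
end

section
/- (Size of the recombining tree.) For every integer k ≥ 0, the set of points of ℝ^n reachable by the walk in k steps, namely { ε_1 + ε_2 + ⋯ + ε_k : ε_u ∈ {e_0, e_1, …, e_n} for each u }, has exactly (k+n)!/(k! n!) = C(n+k, n) elements. -/
theorem sum_count_aux {m : ℕ} {M : Type*} [AddCommMonoid M] (f : Fin m → M)
    (s : Multiset (Fin m)) : (s.map f).sum = ∑ j, s.count j • f j := by
  rw [Finset.sum_multiset_map_count]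
  apply Finset.sum_subset (Finset.subset_univ _)
  intro x _ hx
  rw [Multiset.mem_toFinset] at hx
  rw [Multiset.count_eq_zero_of_notMem hx, zero_smul]

theorem inj_aux {n : ℕ} (E : Matrix (Fin (n + 1)) (Fin (n + 1)) ℝ)
    (hE : E.transpose * E = 1) (hEpos : ∀ j, 0 < E 0 j) (k : ℕ) :
    Function.Injective
      (fun s : Sym (Fin (n + 1)) k => ((s : Multiset (Fin (n + 1))).map (stepVec E)).sum) := by
  intro s t hst
  simp only [sum_count_aux] at hst
  have hcard : ∀ s : Sym (Fin (n + 1)) k,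
      ∑ j, (((s : Multiset (Fin (n + 1))).count j : ℕ) : ℝ) = k := by
    intro s
    have h := sum_count_aux (fun _ => (1 : ℝ)) (s : Multiset (Fin (n + 1)))
    simp at h
    exact h.symm
  let d : Fin (n + 1) → ℝ := fun j =>
    (((s : Multiset (Fin (n + 1))).count j : ℝ) - ((t : Multiset (Fin (n + 1))).count j : ℝ))
      / E 0 j
  have hd : E.mulVec d = 0 := by
    funext i
    refine Fin.cases ?_ (fun i => ?_) i
    · have h : ∀ j, E 0 j * d j = ((s : Multiset (Fin (n + 1))).count j : ℝ)
          - ((t : Multiset (Fin (n + 1))).count j : ℝ) := fun j =>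
        mul_div_cancel₀ _ (hEpos j).ne'
      simp only [Matrix.mulVec, dotProduct, h, Finset.sum_sub_distrib, hcard, sub_self,
        Pi.zero_apply]
    · have h := congrFun hst i
      simp only [Finset.sum_apply, Pi.smul_apply, nsmul_eq_mul, Pi.mul_apply, Pi.natCast_apply, stepVec] at h
      have h2 := sub_eq_zero.mpr h
      rw [← Finset.sum_sub_distrib] at h2
      simp only [Matrix.mulVec, dotProduct, Pi.zero_apply]
      rw [← h2]
      refine Finset.sum_congr rfl fun j _ => ?_
      simp only [d]
      ring
  have hd0 : d = 0 := by
    have h : (E.transpose * E).mulVec d = 0 := by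
      rw [← Matrix.mulVec_mulVec, hd, Matrix.mulVec_zero]
    rwa [hE, Matrix.one_mulVec] at h
  apply Sym.coe_injective
  ext j
  have h := congrFun hd0 j
  simp only [d, Pi.zero_apply, div_eq_zero_iff, (hEpos j).ne', or_false, sub_eq_zero] at h
  exact_mod_cast h

/-- Size of the recombining tree: the set of points reachable in `k` steps of the walk,
`{ε_1 + ⋯ + ε_k : ε_u ∈ {e_0, …, e_n}}`, has exactly `(k+n)!/(k! n!) = C(n+k, n)` elements. -/
theorem card_reachable_states {n : ℕ} (hn : 1 ≤ n)
    (E : Matrix (Fin (n + 1)) (Fin (n + 1)) ℝ)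
    (hE : E.transpose * E = 1) (hEpos : ∀ j, 0 < E 0 j) (k : ℕ) :
    Set.ncard {y : Fin n → ℝ | ∃ ε : Fin k → Fin (n + 1), y = ∑ u, stepVec E (ε u)}
      = Nat.choose (n + k) n := by
  have hset : {y : Fin n → ℝ | ∃ ε : Fin k → Fin (n + 1), y = ∑ u, stepVec E (ε u)}
      = Set.range (fun s : Sym (Fin (n + 1)) k =>
          ((s : Multiset (Fin (n + 1))).map (stepVec E)).sum) := by
    ext y
    constructor
    · rintro ⟨ε, rfl⟩
      refine ⟨⟨(Finset.univ : Finset (Fin k)).val.map ε, by simp⟩, ?_⟩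
      simp only [Sym.coe_mk, Multiset.map_map]
      rfl
    · rintro ⟨⟨s, hs⟩, rfl⟩
      induction s using Quotient.inductionOn with
      | h l =>
        have hl : l.length = k := by simpa using hs
        subst hl
        refine ⟨l.get, ?_⟩
        have h := List.sum_ofFn (f := fun u => stepVec E (l.get u))
        rw [← h]
        have h3 : List.ofFn (fun u => stepVec E (l.get u)) = l.map (stepVec E) := by
          rw [← Function.comp_def, ← List.map_ofFn, List.ofFn_get]
        rw [h3]
        simp
  rw [hset, ← Set.image_univ, Set.ncard_image_of_injective _ (inj_aux E hE hEpos k),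
    Set.ncard_univ, Nat.card_eq_fintype_card, Sym.card_sym_eq_choose, Fintype.card_fin]
  have h : n + 1 + k - 1 = n + k := by omega
  rw [h, Nat.choose_symm_add]
end

section
/- (Invertibility of the volatility matrix.) Let H be an invertible real (n+1)×(n+1) matrix with rows H_0,…,H_n ∈ ℝ^{n+1}, and let g ∈ ℝ^{n+1} be a row vector such that every component of the row vector g H^{-1} is strictly positive. Let Σ be the (n+1)×(n+1) matrix whose first row is g and whose k-th row, for k = 1,…,n, is √N · Σ_{i=0}^n e_{0,i} e_{k,i} H_i (where N ≥ 1 is any fixed integer). Then Σ is invertible. (Applied with H = H^N(t,x), H_i the row of prices at the node x + N^{-1/2} e_i, and g = h^N(t−N^{-1},x), this says that under no-arbitrage and completeness the matrix Σ^N(t,x), whose first row is (h^{0,N}(t−N^{-1},x),…,h^{n,N}(t−N^{-1},x)) and whose k-th row is (∂^N_k h^{0,N}(t,·)(x),…,∂^N_k h^{n,N}(t,·)(x)), is invertible.) -/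
/-- Invertibility of the volatility matrix: if `H` is invertible and every component of the
row vector `g H⁻¹` is strictly positive, then the matrix `Σ` whose first row is `g` and whose
`k`-th row (`k = 1, …, n`) is `√N ∑_i e_{0,i} e_{k,i} H_i` is invertible. -/
theorem volatility_matrix_invertible {n : ℕ} (hn : 1 ≤ n)
    (E : Matrix (Fin (n + 1)) (Fin (n + 1)) ℝ)
    (hE : E.transpose * E = 1) (hEpos : ∀ j, 0 < E 0 j)
    (N : ℕ) (hN : 1 ≤ N)
    (H : Matrix (Fin (n + 1)) (Fin (n + 1)) ℝ) (hH : IsUnit H.det)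
    (g : Fin (n + 1) → ℝ) (hg : ∀ j, 0 < Matrix.vecMul g H⁻¹ j) :
    IsUnit (Matrix.of fun r c : Fin (n + 1) =>
      Fin.cases (g c) (fun k : Fin n =>
        Real.sqrt N * ∑ i, E 0 i * E k.succ i * H i c) r : Matrix (Fin (n+1)) (Fin (n+1)) ℝ).det := by
  rw [isUnit_iff_ne_zero]
  intro hdet
  obtain ⟨v, hv, hSv⟩ := Matrix.exists_mulVec_eq_zero_iff.mpr hdet
  apply hv
  set w := Matrix.mulVec H v with hw
  have hvw : Matrix.mulVec H⁻¹ w = v := by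
    rw [hw, Matrix.mulVec_mulVec, Matrix.nonsing_inv_mul _ hH, Matrix.one_mulVec]
  have h0 : ∑ j, Matrix.vecMul g H⁻¹ j * w j = 0 := by
    have h1 := congrFun hSv 0
    have h2 : dotProduct g v = 0 := by
      simpa [Matrix.mulVec, dotProduct] using h1
    have h3 : dotProduct (Matrix.vecMul g H⁻¹) w = 0 := by
      rw [← Matrix.dotProduct_mulVec, hvw, h2]
    exact h3
  have hNpos : Real.sqrt N ≠ 0 := by
    have : (0 : ℝ) < N := by exact_mod_cast hN
    exact (Real.sqrt_pos.mpr this).ne'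
  set u : Fin (n + 1) → ℝ := fun i => E 0 i * w i with hu
  have hk : ∀ k : Fin n, Matrix.mulVec E u k.succ = 0 := by
    intro k
    have h1 := congrFun hSv k.succ
    have h2 : ∑ c, (Real.sqrt N * ∑ i, E 0 i * E k.succ i * H i c) * v c = 0 := by
      simpa [Matrix.mulVec, dotProduct] using h1
    have h3 : ∑ c, (Real.sqrt N * ∑ i, E 0 i * E k.succ i * H i c) * v c
        = Real.sqrt N * Matrix.mulVec E u k.succ := by
      simp only [Matrix.mulVec, dotProduct, hu, hw, Finset.mul_sum, Finset.sum_mul]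
      rw [Finset.sum_comm]
      refine Finset.sum_congr rfl fun i _ => Finset.sum_congr rfl fun c _ => by ring
    rw [h3] at h2
    exact (mul_eq_zero.mp h2).resolve_left hNpos
  have hwc : ∀ i, w i = Matrix.mulVec E u 0 := by
    intro i
    have h1 : Matrix.mulVec E.transpose (Matrix.mulVec E u) i = u i := by
      rw [Matrix.mulVec_mulVec, hE, Matrix.one_mulVec]
    rw [Matrix.mulVec, dotProduct, Fin.sum_univ_succ] at h1
    simp only [hk, mul_zero, Finset.sum_const_zero, add_zero, Matrix.transpose_apply] at h1
    exact (mul_left_cancel₀ (hEpos i).ne' h1).symm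
  have hc : Matrix.mulVec E u 0 = 0 := by
    simp only [hwc] at h0
    rw [← Finset.sum_mul] at h0
    exact (mul_eq_zero.mp h0).resolve_left
      (Finset.sum_pos (fun j _ => hg j) Finset.univ_nonempty).ne'
  have hw0 : w = 0 := by
    funext i
    rw [hwc, hc]; rfl
  rw [← hvw, hw0, Matrix.mulVec_zero]
end

section
/- (Discrete Black–Scholes PDE for the replication price.) Assume H^N(t,x) is invertible for all grid points (t,x) and the no-arbitrage condition holds: every component of h^N(t,x) H^N(t+N^{-1},x)^{-1} is strictly positive for all grid (t,x). Let v^N be the unique solution of the backward recursion v^N(T_N, x) = Φ^N(x) and v^N(t,x) = h^N(t,x) H^N(t+N^{-1},x)^{-1} · (v^N(t+N^{-1}, x+N^{-1/2}e_0), …, v^N(t+N^{-1}, x+N^{-1/2}e_n))^T for t ∈ [0,T_N)_N and x ∈ ℝ^n. Then the matrix Σ^N(t,x) is invertible and v^N satisfies the discrete partial differential equation ∂^N_t v^N(t,x) + (1/2) Δ^N v^N(t,·)(x) − Σ_{k=1}^n b^N_k(t,x) ∂^N_k v^N(t,·)(x) − c^N(t,x) · v^N(t−N^{-1},x) = 0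 for all t ∈ (0,T_N)_N and x ∈ ℝ^n, where the row vector (c^N(t,x), b^N_1(t,x), …, b^N_n(t,x)) := (∂^N_t h^N(t,x) + (1/2) Δ^N h^N(t,·)(x)) · Σ^N(t,x)^{-1}, the operators ∂^N_t and Δ^N being applied componentwise to the row vector h^N. -/
/-- The price matrix `H^N(t,x)`, with `(i,j)` entry `h^{j,N}(t, x + N^{-1/2} e_i)`, where
`hk = h^N(t, ·)` is the vector of price functions at the given time. -/
noncomputable def Hmat {n : ℕ} (E : Matrix (Fin (n + 1)) (Fin (n + 1)) ℝ) (N : ℕ)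
    (hk : (Fin n → ℝ) → Fin (n + 1) → ℝ) (x : Fin n → ℝ) :
    Matrix (Fin (n + 1)) (Fin (n + 1)) ℝ :=
  Matrix.of fun i j => hk (x + (Real.sqrt N)⁻¹ • stepVec E i) j

/-- The volatility matrix `Σ^N(t,x)`: first row `h^N(t − N⁻¹, x)` (= `hprev x`), and `k`-th row
`(∂^N_k h^{0,N}(t,·)(x), …, ∂^N_k h^{n,N}(t,·)(x))` (from `hcur = h^N(t, ·)`). -/
noncomputable def Sigmat {n : ℕ} (E : Matrix (Fin (n + 1)) (Fin (n + 1)) ℝ) (N : ℕ)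
    (hprev hcur : (Fin n → ℝ) → Fin (n + 1) → ℝ) (x : Fin n → ℝ) :
    Matrix (Fin (n + 1)) (Fin (n + 1)) ℝ :=
  Matrix.of fun r c =>
    Fin.cases (hprev x c) (fun k : Fin n => dpartial E N k (fun y => hcur y c) x) r

/-- The row vector `(c^N, b^N_1, …, b^N_n) = (∂^N_t h^N + (1/2) Δ^N h^N) (Σ^N)⁻¹` at grid time
index `k` (time `t = k/N`, with `hprev = h((k−1)/N, ·)`, `hcur = h(k/N, ·)`). -/
noncomputable def driftCoeffs {n : ℕ} (E : Matrix (Fin (n + 1)) (Fin (n + 1)) ℝ) (N : ℕ)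
    (hprev hcur : (Fin n → ℝ) → Fin (n + 1) → ℝ) (x : Fin n → ℝ) : Fin (n + 1) → ℝ :=
  Matrix.vecMul
    (fun c => (N : ℝ) * (hcur x c - hprev x c) + (1 / 2) * dlap E N (fun y => hcur y c) x)
    (Sigmat E N hprev hcur x)⁻¹

theorem aux_succ {n : ℕ} (E : Matrix (Fin (n + 1)) (Fin (n + 1)) ℝ) (N : ℕ)
    (hp hc : (Fin n → ℝ) → Fin (n + 1) → ℝ) (x : Fin n → ℝ) (g : Fin (n + 1) → ℝ) (k : Fin n) :
    (Sigmat E N hp hc x).mulVec g k.succ =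
      Real.sqrt N * ∑ j, (Hmat E N hc x).mulVec g j * (E 0 j * E k.succ j) := by
  simp only [Matrix.mulVec, dotProduct, Sigmat, Hmat, Matrix.of_apply, Fin.cases_succ, dpartial,
    Finset.mul_sum, Finset.sum_mul]
  rw [Finset.sum_comm]
  refine Finset.sum_congr rfl fun j _ => Finset.sum_congr rfl fun c _ => ?_
  ring

theorem aux_zero {n : ℕ} (E : Matrix (Fin (n + 1)) (Fin (n + 1)) ℝ) (N : ℕ)
    (hp hc : (Fin n → ℝ) → Fin (n + 1) → ℝ) (x : Fin n → ℝ) (g : Fin (n + 1) → ℝ)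
    (hH : IsUnit (Hmat E N hc x).det) :
    (Sigmat E N hp hc x).mulVec g 0 =
      ∑ j, Matrix.vecMul (hp x) (Hmat E N hc x)⁻¹ j * (Hmat E N hc x).mulVec g j := by
  change hp x ⬝ᵥ g = Matrix.vecMul (hp x) (Hmat E N hc x)⁻¹ ⬝ᵥ (Hmat E N hc x).mulVec g
  rw [Matrix.dotProduct_mulVec, Matrix.vecMul_vecMul, Matrix.nonsing_inv_mul _ hH,
    Matrix.vecMul_one]

theorem aux_drift {n : ℕ} (E : Matrix (Fin (n + 1)) (Fin (n + 1)) ℝ) (N : ℕ)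
    (hq : ∑ j, E 0 j ^ 2 = 1) (f : (Fin n → ℝ) → ℝ) (p : ℝ) (x : Fin n → ℝ) :
    (N : ℝ) * (f x - p) + (1 / 2) * dlap E N f x =
      N * (∑ j, f (x + (Real.sqrt N)⁻¹ • stepVec E j) * E 0 j ^ 2 - p) := by
  simp only [dlap, sub_mul, Finset.sum_sub_distrib, ← Finset.mul_sum, hq]
  ring

theorem aux_unit {n : ℕ} (E : Matrix (Fin (n + 1)) (Fin (n + 1)) ℝ)
    (hE : E.transpose * E = 1) (hEpos : ∀ j, 0 < E 0 j) (N : ℕ) (hN : 1 ≤ N)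
    (hp hc : (Fin n → ℝ) → Fin (n + 1) → ℝ) (x : Fin n → ℝ)
    (hH : IsUnit (Hmat E N hc x).det)
    (hNA : ∀ j, 0 < Matrix.vecMul (hp x) (Hmat E N hc x)⁻¹ j) :
    IsUnit (Sigmat E N hp hc x).det := by
  rw [isUnit_iff_ne_zero]
  intro h0
  obtain ⟨g, hg, hg0⟩ := Matrix.exists_mulVec_eq_zero_iff.mpr h0
  have hs : Real.sqrt N ≠ 0 := by
    have : (0 : ℝ) < N := by exact_mod_cast hN
    exact (Real.sqrt_pos.mpr this).ne'
  set V := (Hmat E N hc x).mulVec g with hV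
  let w : Fin (n + 1) → ℝ := fun j => V j * E 0 j
  have hw : ∀ k : Fin n, E.mulVec w k.succ = 0 := by
    intro k
    have h1 := aux_succ E N hp hc x g k
    rw [hg0, ← hV] at h1
    have h2 := (mul_eq_zero.mp h1.symm).resolve_left hs
    rw [← h2]
    simp only [Matrix.mulVec, dotProduct, w]
    refine Finset.sum_congr rfl fun j _ => ?_
    ring
  have hw2 : ∀ j, w j = E 0 j * E.mulVec w 0 := by
    intro j
    have : w = E.transpose.mulVec (E.mulVec w) := by
      rw [Matrix.mulVec_mulVec, hE, Matrix.one_mulVec]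
    have h3 := congrFun this j
    rw [h3]
    conv_lhs => rw [Matrix.mulVec, dotProduct, Fin.sum_univ_succ]
    simp only [hw, mul_zero, Finset.sum_const_zero, add_zero, Matrix.transpose_apply]
  have hVc : ∀ j, V j = E.mulVec w 0 := fun j =>
    mul_right_cancel₀ (hEpos j).ne' (by rw [mul_comm _ (E 0 j), mul_comm _ (E 0 j), ← hw2 j, mul_comm])
  have h4 := aux_zero E N hp hc x g hH
  rw [hg0, ← hV] at h4
  simp only [hVc, ← Finset.sum_mul] at h4
  have h5 : E.mulVec w 0 = 0 := by
    refine (mul_eq_zero.mp h4.symm).resolve_left (ne_of_gt ?_)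
    exact Finset.sum_pos (fun j _ => hNA j) Finset.univ_nonempty
  apply hg
  have h6 : V = 0 := by
    funext j
    rw [hVc, h5]; rfl
  have : g = (Hmat E N hc x)⁻¹.mulVec V := by
    rw [hV, Matrix.mulVec_mulVec, Matrix.nonsing_inv_mul _ hH, Matrix.one_mulVec]
  rw [this, h6, Matrix.mulVec_zero]

/-- Discrete Black–Scholes PDE for the replication price: under no arbitrage and completeness,
`Σ^N(t,x)` is invertible and the solution `v^N` of the backward pricing recursion satisfies
`∂^N_t v^N + (1/2) Δ^N v^N − ⟨b^N, ∇^N v^N⟩ − c^N (1^N v^N) = 0` on the grid.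
Time is indexed by `k ∈ ℕ` (grid time `t = k/N`, terminal index `M`, `T_N = M/N`). -/
theorem discrete_PDE_for_replication_price {n : ℕ} (hn : 1 ≤ n)
    (E : Matrix (Fin (n + 1)) (Fin (n + 1)) ℝ)
    (hE : E.transpose * E = 1) (hEpos : ∀ j, 0 < E 0 j)
    (N M : ℕ) (hN : 1 ≤ N)
    (h : ℕ → (Fin n → ℝ) → Fin (n + 1) → ℝ) (Φ : (Fin n → ℝ) → ℝ)
    (hinv : ∀ k ≤ M, ∀ x, IsUnit (Hmat E N (h k) x).det)
    (hNA : ∀ k < M, ∀ x, ∀ j, 0 < Matrix.vecMul (h k x) (Hmat E N (h (k + 1)) x)⁻¹ j)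
    (v : ℕ → (Fin n → ℝ) → ℝ)
    (hterm : ∀ x, v M x = Φ x)
    (hrec : ∀ k < M, ∀ x, v k x =
      ∑ i, Matrix.vecMul (h k x) (Hmat E N (h (k + 1)) x)⁻¹ i
        * v (k + 1) (x + (Real.sqrt N)⁻¹ • stepVec E i)) :
    ∀ k, 0 < k → k < M → ∀ x,
      IsUnit (Sigmat E N (h (k - 1)) (h k) x).det ∧
        (N : ℝ) * (v k x - v (k - 1) x) + (1 / 2) * dlap E N (v k) x
          - (∑ j : Fin n,
              driftCoeffs E N (h (k - 1)) (h k) x j.succ * dpartial E N j (v k) x)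
          - driftCoeffs E N (h (k - 1)) (h k) x 0 * v (k - 1) x = 0 := by
  intro k hk hkM x
  obtain ⟨m, rfl⟩ : ∃ m, k = m + 1 := ⟨k - 1, by omega⟩
  simp only [Nat.add_sub_cancel]
  have hH := hinv (m + 1) hkM.le x
  have hU := aux_unit E hE hEpos N hN (h m) (h (m + 1)) x hH (hNA m (by omega) x)
  refine ⟨hU, ?_⟩
  have hq : ∑ j, E 0 j ^ 2 = 1 := by
    have hE2 : E * E.transpose = 1 := mul_eq_one_comm.mp hE
    have := congrArg (fun A => A 0 0) hE2
    simpa [Matrix.mul_apply, sq] using this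
  set V : Fin (n + 1) → ℝ := fun j => v (m + 1) (x + (Real.sqrt N)⁻¹ • stepVec E j) with hV
  let g := (Hmat E N (h (m + 1)) x)⁻¹.mulVec V
  have hg : (Hmat E N (h (m + 1)) x).mulVec g = V := by
    simp only [g]
    rw [Matrix.mulVec_mulVec, Matrix.mul_nonsing_inv _ hH, Matrix.one_mulVec]
  have e0 : v m x = (Sigmat E N (h m) (h (m + 1)) x).mulVec g 0 := by
    rw [aux_zero _ _ _ _ _ _ hH, hg, hrec m (by omega) x]
  have es : ∀ j : Fin n, dpartial E N j (v (m + 1)) x =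
      (Sigmat E N (h m) (h (m + 1)) x).mulVec g j.succ := by
    intro j
    rw [aux_succ, hg]; rfl
  have key : driftCoeffs E N (h m) (h (m + 1)) x ⬝ᵥ
      (Sigmat E N (h m) (h (m + 1)) x).mulVec g =
      N * (∑ j, V j * E 0 j ^ 2 - v m x) := by
    rw [driftCoeffs, Matrix.dotProduct_mulVec, Matrix.vecMul_vecMul,
      Matrix.nonsing_inv_mul _ hU, Matrix.vecMul_one]
    have e0' : v m x = ∑ c, h m x c * g c := e0
    rw [← hg, e0']
    simp only [dotProduct, Matrix.mulVec, Hmat, Matrix.of_apply]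
    have : ∀ c, (N : ℝ) * (h (m + 1) x c - h m x c) +
        (1 / 2) * dlap E N (fun y => h (m + 1) y c) x =
        N * (∑ j, h (m + 1) (x + (Real.sqrt N)⁻¹ • stepVec E j) c * E 0 j ^ 2 - h m x c) :=
      fun c => aux_drift E N hq (fun y => h (m + 1) y c) _ x
    simp only [this, mul_assoc, ← Finset.mul_sum, sub_mul, Finset.sum_sub_distrib, Finset.sum_mul]
    rw [Finset.sum_comm]
    congr 2
    refine Finset.sum_congr rfl fun j _ => Finset.sum_congr rfl fun c _ => ?_
    ring
  rw [dotProduct, Fin.sum_univ_succ, ← e0] at key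
  simp only [← es] at key
  rw [aux_drift E N hq (v (m + 1)) (v m x) x]
  linarith
end

section
/- (Order-N^{-1/2} convergence of He's discrete market prices.) Assume: (i) for every N the market is arbitrage-free and complete, i.e. H^N(t,x) is invertible and every component of h^N(t,x) H^N(t+N^{-1},x)^{-1} is strictly positive for all grid (t,x); (ii) the sum A(t,x) of the components of h^N(t,x) H^N(t+N^{-1},x)^{-1} satisfies 0 < A(t,x) < 1 (positive interest rate); (iii) there are bounded functions b : [0,T] × ℝ^n → ℝ^n, c : [0,T] × ℝ^n → ℝ (c continuous) and bounded Φ : ℝ^n → ℝ with sup_N sup_{(t,x) ∈ [0,T]_N × ℝ^n} N^{1/2}( |b − b^N| + |c − c^N| + |Φ − Φ^N| ) < ∞, where (c^N, b^N) := (∂^N_t h^N + (1/2)Δ^N h^N) (Σ^N)^{-1}; and (iv) the terminal value problem ∂ν/∂t + (1/2)Δν − ⟨b, ∇ν⟩ − c ν = 0 on [0,T) × ℝ^n, ν(T,·) = Φ, has a bounded C^{1,3} solution ν whose spatial derivatives up to order 3 are bounded and whose time derivative is bounded and uniformly Lipschitz in t. Let v^N solve the backward pricing recursion v^N(T_N,x)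 = Φ^N(x), v^N(t,x) = h^N(t,x) H^N(t+N^{-1},x)^{-1} (v^N(t+N^{-1}, x+N^{-1/2}e_0),…,v^N(t+N^{-1}, x+N^{-1/2}e_n))^T. Then there is a constant C such that for all N ≥ 1 and all (t,x) ∈ [0,T]_N × ℝ^n: |ν(t,x) − v^N(t,x)| ≤ C N^{-1/2}. -/
lemma He_weights {n : ℕ} (E : Matrix (Fin (n + 1)) (Fin (n + 1)) ℝ)
    (hE : E.transpose * E = 1) (hEpos : ∀ j, 0 < E 0 j) (N : ℕ) (hN : 1 ≤ N)
    (hprev hcur : (Fin n → ℝ) → Fin (n + 1) → ℝ) (x : Fin n → ℝ)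
    (hinv : IsUnit (Hmat E N hcur x).det)
    (hA : 0 < ∑ j, Matrix.vecMul (hprev x) (Hmat E N hcur x)⁻¹ j) (j : Fin (n + 1)) :
    ((N : ℝ) + driftCoeffs E N hprev hcur x 0)
        * Matrix.vecMul (hprev x) (Hmat E N hcur x)⁻¹ j
      = N * (E 0 j) ^ 2 - Real.sqrt N *
        ∑ k : Fin n, driftCoeffs E N hprev hcur x k.succ * (E 0 j * E k.succ j) := by
  have hEE : E * E.transpose = 1 := mul_eq_one_comm.mp hE
  have hrow : ∀ a b, ∑ j, E a j * E b j = if a = b then 1 else 0 := by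
    intro a b
    have := congrFun (congrFun hEE a) b
    simpa [Matrix.mul_apply, Matrix.one_apply] using this
  have hs : 0 < Real.sqrt N := Real.sqrt_pos.mpr (by exact_mod_cast hN)
  set s := Real.sqrt N with hsdef
  set H := Hmat E N hcur x with hH
  set q := Matrix.vecMul (hprev x) H⁻¹ with hq
  have hqH : Matrix.vecMul q H = hprev x := by
    rw [hq, Matrix.vecMul_vecMul, Matrix.nonsing_inv_mul _ hinv, Matrix.vecMul_one]
  let W : Matrix (Fin (n + 1)) (Fin (n + 1)) ℝ := Matrix.of fun r c =>
    Fin.cases (q c) (fun k : Fin n => s * (E 0 c * E k.succ c)) r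
  have hW0 : ∀ c, W 0 c = q c := fun c => rfl
  have hWs : ∀ (k : Fin n) c, W k.succ c = s * (E 0 c * E k.succ c) := fun k c => rfl
  have hSW : Sigmat E N hprev hcur x = W * H := by
    ext r c
    refine Fin.cases ?_ (fun k => ?_) r
    · rw [Matrix.mul_apply]
      simp only [hW0]
      have := congrFun hqH c
      simpa [Matrix.vecMul, dotProduct, Sigmat] using this.symm
    · rw [Matrix.mul_apply]
      simp only [hWs]
      simp only [Sigmat, dpartial, Matrix.of_apply, Fin.cases_succ, Finset.mul_sum, hH, Hmat]
      refine Finset.sum_congr rfl fun i _ => ?_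
      rw [← hsdef]; ring
  have hWu : IsUnit W := by
    rw [← Matrix.vecMul_injective_iff_isUnit]
    have key : ∀ d, Matrix.vecMul d W = 0 → d = 0 := by
      intro d hd
      have hd' : ∀ c, d 0 * q c + ∑ k : Fin n, d k.succ * (s * (E 0 c * E k.succ c)) = 0 := by
        intro c
        have := congrFun hd c
        simpa [Matrix.vecMul, dotProduct, Fin.sum_univ_succ, hW0, hWs] using this
      have h0 : d 0 = 0 := by
        have h1 : ∑ c, (d 0 * q c + ∑ k : Fin n, d k.succ * (s * (E 0 c * E k.succ c))) = 0 :=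
          Finset.sum_eq_zero fun c _ => hd' c
        rw [Finset.sum_add_distrib, Finset.sum_comm, ← Finset.mul_sum] at h1
        have h2 : ∑ y : Fin n, ∑ c, d y.succ * (s * (E 0 c * E y.succ c)) = 0 := by
          refine Finset.sum_eq_zero fun k _ => ?_
          rw [← Finset.mul_sum, ← Finset.mul_sum, hrow, if_neg (Fin.succ_ne_zero k).symm]
          simp
        rw [h2, add_zero] at h1
        exact (mul_eq_zero.mp h1).resolve_right hA.ne'
      have h3 : ∀ c, ∑ k : Fin n, d k.succ * E k.succ c = 0 := by
        intro c
        have := hd' c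
        rw [h0, zero_mul, zero_add] at this
        have h4 : ∑ k : Fin n, d k.succ * (s * (E 0 c * E k.succ c))
            = (s * E 0 c) * ∑ k : Fin n, d k.succ * E k.succ c := by
          rw [Finset.mul_sum]; exact Finset.sum_congr rfl fun k _ => by ring
        rw [h4] at this
        exact (mul_eq_zero.mp this).resolve_left (mul_pos hs (hEpos c)).ne'
      funext r
      refine Fin.cases h0 (fun l => ?_) r
      have h5 : ∑ c, (∑ k : Fin n, d k.succ * E k.succ c) * E l.succ c = 0 :=
        Finset.sum_eq_zero fun c _ => by rw [h3, zero_mul]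
      simp only [Finset.sum_mul] at h5
      rw [Finset.sum_comm] at h5
      simp only [mul_assoc, ← Finset.mul_sum, hrow] at h5
      simpa using h5
    intro a b hab
    have := key (a - b) (by rw [Matrix.sub_vecMul]; exact sub_eq_zero.mpr hab)
    exact sub_eq_zero.mp this
  set d := driftCoeffs E N hprev hcur x with hd
  have hnum : (fun c => (N : ℝ) * (hcur x c - hprev x c)
      + (1 / 2) * dlap E N (fun y => hcur y c) x)
      = Matrix.vecMul (fun j => (N : ℝ) * ((E 0 j) ^ 2 - q j)) H := by
    funext c
    have hp : ∑ j, E 0 j ^ 2 = 1 := by simpa [sq] using hrow 0 0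
    have hqc : ∑ i, q i * H i c = hprev x c := congrFun hqH c
    have : ∑ j, (hcur (x + s⁻¹ • stepVec E j) c - hcur x c) * E 0 j ^ 2
        = ∑ j, E 0 j ^ 2 * H j c - hcur x c := by
      simp only [sub_mul, Finset.sum_sub_distrib, ← Finset.mul_sum, hp, mul_one]
      congr 1
      exact Finset.sum_congr rfl fun i _ => by rw [mul_comm]; rfl
    simp only [dlap, Matrix.vecMul, dotProduct]
    rw [← hsdef, this, ← hqc]
    simp only [mul_sub, sub_mul, Finset.sum_sub_distrib, mul_assoc, ← Finset.mul_sum]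
    ring
  have hdW : Matrix.vecMul d W = fun j => (N : ℝ) * ((E 0 j) ^ 2 - q j) := by
    have hWd : IsUnit W.det := (Matrix.isUnit_iff_isUnit_det W).mp hWu
    rw [hd, driftCoeffs, hnum, hSW, Matrix.mul_inv_rev, Matrix.vecMul_vecMul, Matrix.vecMul_vecMul,
      Matrix.mul_assoc, Matrix.nonsing_inv_mul _ hWd, Matrix.mul_one,
      Matrix.mul_nonsing_inv _ hinv, Matrix.vecMul_one]
  have := congrFun hdW j
  have h6 : d 0 * q j + ∑ k : Fin n, d k.succ * (s * (E 0 j * E k.succ j))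
      = (N : ℝ) * ((E 0 j) ^ 2 - q j) := by
    simpa [Matrix.vecMul, dotProduct, Fin.sum_univ_succ, hW0, hWs] using this
  have h7 : ∑ k : Fin n, d k.succ * (s * (E 0 j * E k.succ j))
      = s * ∑ k : Fin n, d k.succ * (E 0 j * E k.succ j) := by
    rw [Finset.mul_sum]; exact Finset.sum_congr rfl fun k _ => by ring
  rw [h7] at h6
  linarith

lemma He_apply {n : ℕ} (E : Matrix (Fin (n + 1)) (Fin (n + 1)) ℝ)
    (hE : E.transpose * E = 1) (N : ℕ) (a : ℝ) (β : Fin n → ℝ) (q : Fin (n + 1) → ℝ)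
    (hq : ∀ j, (N + a) * q j = N * (E 0 j) ^ 2 - Real.sqrt N *
        ∑ k : Fin n, β k * (E 0 j * E k.succ j))
    (f : (Fin n → ℝ) → ℝ) (x : Fin n → ℝ) :
    (N + a) * ∑ j, q j * f (x + (Real.sqrt N)⁻¹ • stepVec E j)
      = N * f x + (1 / 2) * dlap E N f x - ∑ k, β k * dpartial E N k f x := by
  have hEE : E * E.transpose = 1 := mul_eq_one_comm.mp hE
  have hp : ∑ j, E 0 j ^ 2 = 1 := by
    have := congrFun (congrFun hEE 0) 0
    simpa [Matrix.mul_apply, sq] using this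
  rw [Finset.mul_sum]
  simp only [← mul_assoc, hq, dlap, dpartial]
  simp only [sub_mul, Finset.sum_sub_distrib, ← Finset.mul_sum, hp]
  have h1 : ∑ j, (N:ℝ) * E 0 j ^ 2 * f (x + (Real.sqrt N)⁻¹ • stepVec E j)
     = N * ∑ j, f (x + (Real.sqrt N)⁻¹ • stepVec E j) * E 0 j ^ 2 := by
    rw [Finset.mul_sum]; exact Finset.sum_congr rfl fun k _ => by ring
  have h2 : ∑ j, (Real.sqrt N * ∑ k : Fin n, β k * (E 0 j * E k.succ j))
        * f (x + (Real.sqrt N)⁻¹ • stepVec E j)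
     = ∑ k : Fin n, β k * Real.sqrt N *
        ∑ j, f (x + (Real.sqrt N)⁻¹ • stepVec E j) * (E 0 j * E k.succ j) := by
    simp only [Finset.mul_sum, Finset.sum_mul]
    rw [Finset.sum_comm]
    exact Finset.sum_congr rfl fun k _ => Finset.sum_congr rfl fun j _ => by ring
  have h1' := h1
  simp only [mul_assoc] at h1' h2 ⊢
  rw [h1', h2]
  ring

set_option maxSynthPendingDepth 3 in
lemma He_taylor {V : Type*} [NormedAddCommGroup V] [NormedSpace ℝ V]
    (f : V → ℝ) (hf : ContDiff ℝ 3 f) (C : ℝ)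
    (hC : ∀ i ≤ 3, ∀ x, ‖iteratedFDeriv ℝ i f x‖ ≤ C) (x y : V) :
    |f (x + y) - f x - fderiv ℝ f x y| ≤ C * ‖y‖ ^ 2 ∧
    |f (x + y) - f x - fderiv ℝ f x y - (1 / 2) * fderiv ℝ (fderiv ℝ f) x y y| ≤ C * ‖y‖ ^ 3 := by
  have hC0 : 0 ≤ C := (norm_nonneg _).trans (hC 0 (by norm_num) x)
  have hf1 : Differentiable ℝ f := hf.differentiable (by norm_num)
  have hF : ContDiff ℝ 2 (fderiv ℝ f) := hf.fderiv_right (by norm_num)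
  have hF1 : Differentiable ℝ (fderiv ℝ f) := hF.differentiable (by norm_num)
  have hG : ContDiff ℝ 1 (fderiv ℝ (fderiv ℝ f)) := hF.fderiv_right (by norm_num)
  have hG1 : Differentiable ℝ (fderiv ℝ (fderiv ℝ f)) := hG.differentiable (by norm_num)
  have b2 : ∀ z, ‖fderiv ℝ (fderiv ℝ f) z‖ ≤ C := by
    intro z
    have := hC 2 (by norm_num) z
    rwa [← norm_iteratedFDeriv_fderiv, ← norm_iteratedFDeriv_fderiv, norm_iteratedFDeriv_zero] at this
  have b3 : ∀ z, ‖fderiv ℝ (fderiv ℝ (fderiv ℝ f)) z‖ ≤ C := by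
    intro z
    have := hC 3 (by norm_num) z
    rwa [← norm_iteratedFDeriv_fderiv, ← norm_iteratedFDeriv_fderiv, ← norm_iteratedFDeriv_fderiv,
      norm_iteratedFDeriv_zero] at this
  have lipG : ∀ z w, ‖fderiv ℝ (fderiv ℝ f) w - fderiv ℝ (fderiv ℝ f) z‖ ≤ C * ‖w - z‖ :=
    fun z w => Convex.norm_image_sub_le_of_norm_fderiv_le (s := Set.univ)
      (fun a _ => hG1 a) (fun a _ => b3 a) convex_univ trivial trivial
  have lipF : ∀ z w, ‖fderiv ℝ f w - fderiv ℝ f z‖ ≤ C * ‖w - z‖ :=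
    fun z w => Convex.norm_image_sub_le_of_norm_fderiv_le (s := Set.univ)
      (fun a _ => hF1 a) (fun a _ => b2 a) convex_univ trivial trivial
  have hline : ∀ s : ℝ, HasDerivAt (fun s : ℝ => x + s • y) y s := by
    intro s
    simpa using ((hasDerivAt_id s).smul_const y).const_add x
  have e2 : ∀ s : ℝ, ‖s • y‖ = |s| * ‖y‖ := fun s => by rw [norm_smul, Real.norm_eq_abs]
  -- second order for the gradient
  have quadF : ∀ s ∈ Set.Icc (0:ℝ) 1,
      ‖fderiv ℝ f (x + s • y) - fderiv ℝ f x - s • fderiv ℝ (fderiv ℝ f) x y‖ ≤ C * ‖y‖ ^ 2 := by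
    have hd : ∀ s : ℝ, HasDerivAt (fun s : ℝ => fderiv ℝ f (x + s • y) - s • fderiv ℝ (fderiv ℝ f) x y)
        (fderiv ℝ (fderiv ℝ f) (x + s • y) y - fderiv ℝ (fderiv ℝ f) x y) s := by
      intro s
      have h1 := (hF1 (x + s • y)).hasFDerivAt.comp_hasDerivAt s (hline s)
      have h2 := (hasDerivAt_id s).smul_const (fderiv ℝ (fderiv ℝ f) x y)
      exact (h1.sub h2).congr_deriv (by simp)
    intro s hs
    have := norm_image_sub_le_of_norm_deriv_le_segment' (C := C * ‖y‖ ^ 2) (a := 0) (b := 1)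
      (fun s _ => (hd s).hasDerivWithinAt) (by
        intro t ht
        rw [← _root_.sub_apply]
        refine (ContinuousLinearMap.le_opNorm _ _).trans ?_
        have h3 := lipG x (x + t • y)
        rw [add_sub_cancel_left, e2, abs_of_nonneg ht.1] at h3
        calc _ ≤ C * (t * ‖y‖) * ‖y‖ := by gcongr
          _ ≤ C * (1 * ‖y‖) * ‖y‖ := by gcongr; exact ht.2.le
          _ = _ := by ring) s hs
    simp only [zero_smul, add_zero, sub_zero] at this
    rw [sub_right_comm]
    refine this.trans ?_
    have := hs.2
    nlinarith [mul_nonneg hC0 (sq_nonneg ‖y‖)]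
  constructor
  · have hd : ∀ s : ℝ, HasDerivAt (fun s : ℝ => f (x + s • y) - s * fderiv ℝ f x y)
        (fderiv ℝ f (x + s • y) y - fderiv ℝ f x y) s := by
      intro s
      have h1 := (hf1 (x + s • y)).hasFDerivAt.comp_hasDerivAt s (hline s)
      have h2 := (hasDerivAt_id s).mul_const (fderiv ℝ f x y)
      exact (h1.sub h2).congr_deriv (by simp)
    have := norm_image_sub_le_of_norm_deriv_le_segment_01' (C := C * ‖y‖ ^ 2)
      (fun s _ => (hd s).hasDerivWithinAt) (by
        intro t ht
        rw [← _root_.sub_apply]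
        refine (ContinuousLinearMap.le_opNorm _ _).trans ?_
        have h3 := lipF x (x + t • y)
        rw [add_sub_cancel_left, e2, abs_of_nonneg ht.1] at h3
        calc _ ≤ C * (t * ‖y‖) * ‖y‖ := by gcongr
          _ ≤ C * (1 * ‖y‖) * ‖y‖ := by gcongr; exact ht.2.le
          _ = _ := by ring)
    simp only [zero_smul, add_zero, one_smul, one_mul, zero_mul, sub_zero, Real.norm_eq_abs] at this
    rwa [sub_right_comm]
  · have hd : ∀ s : ℝ, HasDerivAt (fun s : ℝ => f (x + s • y) - s * fderiv ℝ f x y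
          - s ^ 2 * ((1 / 2) * fderiv ℝ (fderiv ℝ f) x y y))
        ((fderiv ℝ f (x + s • y) - fderiv ℝ f x - s • fderiv ℝ (fderiv ℝ f) x y) y) s := by
      intro s
      have h1 := (hf1 (x + s • y)).hasFDerivAt.comp_hasDerivAt s (hline s)
      have h2 := (hasDerivAt_id s).mul_const (fderiv ℝ f x y)
      have h3 := ((hasDerivAt_id s).pow 2).mul_const ((1 / 2) * fderiv ℝ (fderiv ℝ f) x y y)
      refine ((h1.sub h2).sub h3).congr_deriv ?_
      simp
      ring
    have := norm_image_sub_le_of_norm_deriv_le_segment_01' (C := C * ‖y‖ ^ 3)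
      (fun s _ => (hd s).hasDerivWithinAt) (by
        intro t ht
        refine (ContinuousLinearMap.le_opNorm _ _).trans ?_
        have h3 := quadF t ⟨ht.1, ht.2.le⟩
        calc _ ≤ (C * ‖y‖ ^ 2) * ‖y‖ := by gcongr
          _ = _ := by ring)
    simp only [zero_smul, add_zero, one_smul, one_mul, zero_mul, sub_zero, Real.norm_eq_abs, one_pow,
      ne_eq, OfNat.ofNat_ne_zero, not_false_eq_true, zero_pow] at this
    convert this using 2
    ring

lemma He_ops {n : ℕ} (E : Matrix (Fin (n + 1)) (Fin (n + 1)) ℝ)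
    (hE : E.transpose * E = 1) (hEpos : ∀ j, 0 < E 0 j) :
    ∃ K : ℝ, 0 ≤ K ∧ ∀ (C : ℝ) (f : (Fin n → ℝ) → ℝ), ContDiff ℝ 3 f →
      (∀ i ≤ 3, ∀ x, ‖iteratedFDeriv ℝ i f x‖ ≤ C) → ∀ N : ℕ, 1 ≤ N → ∀ x,
        |(1 / 2) * dlap E N f x - (1 / 2) * lap f x| ≤ K * C / Real.sqrt N ∧
        ∀ k, |dpartial E N k f x - fderiv ℝ f x (Pi.single k 1)| ≤ K * C / Real.sqrt N := by
  have hEE : E * E.transpose = 1 := mul_eq_one_comm.mp hE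
  have hrow : ∀ a b, ∑ j, E a j * E b j = if a = b then 1 else 0 := by
    intro a b
    have := congrFun (congrFun hEE a) b
    simpa [Matrix.mul_apply, Matrix.one_apply] using this
  have hE1 : ∀ a j, |E a j| ≤ 1 := by
    intro a j
    have h1 := hrow a a
    rw [if_pos rfl] at h1
    have h2 : E a j * E a j ≤ ∑ j, E a j * E a j :=
      Finset.single_le_sum (f := fun j => E a j * E a j) (fun i _ => mul_self_nonneg _)
        (Finset.mem_univ j)
    rw [h1] at h2
    exact abs_le_one_iff_mul_self_le_one.mpr h2
  have hw : ∀ a b j, |E a j * E b j| ≤ 1 := fun a b j => by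
    rw [abs_mul]; exact mul_le_one₀ (hE1 a j) (abs_nonneg _) (hE1 b j)
  have hse : ∀ j l, E 0 j * stepVec E j l = E l.succ j := fun j l => by
    simp only [stepVec]; field_simp [(hEpos j).ne']
  -- vector identities
  have hv1 : ∀ k : Fin n, ∑ j, (E 0 j * E k.succ j) • stepVec E j = Pi.single k 1 := by
    intro k
    funext l
    simp only [Finset.sum_apply, Pi.smul_apply, smul_eq_mul]
    have : ∀ j, E 0 j * E k.succ j * stepVec E j l = E k.succ j * E l.succ j := fun j => by
      rw [← hse j l]; ring
    simp only [this, hrow, Fin.succ_inj, Pi.single_apply, eq_comm]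
  have hv0 : ∑ j, (E 0 j ^ 2) • stepVec E j = 0 := by
    funext l
    simp only [Finset.sum_apply, Pi.smul_apply, smul_eq_mul, Pi.zero_apply]
    have : ∀ j, E 0 j ^ 2 * stepVec E j l = E 0 j * E l.succ j := fun j => by
      rw [← hse j l]; ring
    simp only [this, hrow, if_neg (Fin.succ_ne_zero l).symm]
  have hv2 : ∀ G : (Fin n → ℝ) →L[ℝ] (Fin n → ℝ) →L[ℝ] ℝ,
      ∑ j, E 0 j ^ 2 * G (stepVec E j) (stepVec E j)
        = ∑ i, G (Pi.single i 1) (Pi.single i 1) := by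
    intro G
    have hexp : ∀ u w : Fin n → ℝ, G u w
        = ∑ k, ∑ l, u k * w l * G (Pi.single k 1) (Pi.single l 1) := by
      intro u w
      conv_lhs => rw [pi_eq_sum_univ' u, pi_eq_sum_univ' w]
      simp only [map_sum, map_smul, _root_.sum_apply, _root_.smul_apply,
        smul_eq_mul, Finset.mul_sum]
      rw [Finset.sum_comm]
      refine Finset.sum_congr rfl fun k _ => Finset.sum_congr rfl fun l _ => ?_
      have hb : ∀ i : Fin n, (fun j => if i = j then (1:ℝ) else 0) = Pi.single i 1 := by
        intro i; funext j; simp [Pi.single_apply, eq_comm]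
      ring_nf
    have h1 : ∀ j, E 0 j ^ 2 * G (stepVec E j) (stepVec E j)
        = ∑ k : Fin n, ∑ l : Fin n, (E k.succ j * E l.succ j) *
          G (Pi.single k 1) (Pi.single l 1) := by
      intro j
      rw [hexp, Finset.mul_sum]
      refine Finset.sum_congr rfl fun k _ => ?_
      rw [Finset.mul_sum]
      refine Finset.sum_congr rfl fun l _ => ?_
      rw [← hse j k, ← hse j l]; ring
    simp only [h1]
    rw [Finset.sum_comm]
    refine Finset.sum_congr rfl fun k _ => ?_
    rw [Finset.sum_comm]
    simp only [← Finset.sum_mul, hrow, Fin.succ_inj]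
    simp
  let B : ℝ := 1 + ∑ j, ‖stepVec E j‖
  have hB1 : 1 ≤ B := by
    have : 0 ≤ ∑ j, ‖stepVec E j‖ := Finset.sum_nonneg fun j _ => norm_nonneg _
    simp only [B]; linarith
  have hB : ∀ j, ‖stepVec E j‖ ≤ B := fun j => by
    have := Finset.single_le_sum (f := fun j => ‖stepVec E j‖) (fun i _ => norm_nonneg _)
      (Finset.mem_univ j)
    simp only [B]; linarith
  refine ⟨(n + 1) * B ^ 3, by positivity, ?_⟩
  intro C f hf hC N hN x
  have hC0 : 0 ≤ C := (norm_nonneg _).trans (hC 0 (by norm_num) x)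
  have hNr : (0:ℝ) < N := by exact_mod_cast hN
  have hs : 0 < Real.sqrt N := Real.sqrt_pos.mpr hNr
  have hss : Real.sqrt N * Real.sqrt N = N := Real.mul_self_sqrt hNr.le
  unfold dlap dpartial
  set s := Real.sqrt N with hsdef
  have hT := fun j => He_taylor f hf C hC x (s⁻¹ • stepVec E j)
  have hnorm : ∀ j, ‖s⁻¹ • stepVec E j‖ ≤ s⁻¹ * B := fun j => by
    rw [norm_smul, Real.norm_eq_abs, abs_of_pos (inv_pos.mpr hs)]
    exact mul_le_mul_of_nonneg_left (hB j) (inv_pos.mpr hs).le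
  have hcard : ∀ a : ℝ, ∑ _j : Fin (n + 1), a = (n + 1) * a := fun a => by simp
  constructor
  · have hlap : lap f x = ∑ i, fderiv ℝ (fderiv ℝ f) x (Pi.single i 1) (Pi.single i 1) := by
      unfold lap
      refine Finset.sum_congr rfl fun i _ => ?_
      have hF1 : Differentiable ℝ (fderiv ℝ f) :=
        (hf.fderiv_right (m := 2) (by norm_num)).differentiable (by norm_num)
      rw [fderiv_clm_apply (hF1 x) (differentiableAt_const _)]
      simp
    have hid : (1 / 2) * (2 * N * ∑ j, (f (x + s⁻¹ • stepVec E j) - f x) * E 0 j ^ 2)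
          - (1 / 2) * lap f x
        = N * ∑ j, (f (x + s⁻¹ • stepVec E j) - f x - fderiv ℝ f x (s⁻¹ • stepVec E j)
            - (1 / 2) * fderiv ℝ (fderiv ℝ f) x (s⁻¹ • stepVec E j) (s⁻¹ • stepVec E j))
            * (E 0 j * E 0 j) := by
      have h1 : ∑ j, fderiv ℝ f x (s⁻¹ • stepVec E j) * (E 0 j * E 0 j) = 0 := by
        have := congrArg (fun u => s⁻¹ * fderiv ℝ f x u) hv0
        simp only [map_sum, map_smul, smul_eq_mul, map_zero, mul_zero, Finset.mul_sum] at this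
        rw [← this]
        refine Finset.sum_congr rfl fun j _ => ?_
        rw [map_smul, smul_eq_mul]; ring
      have h2 : N * ∑ j, (fderiv ℝ (fderiv ℝ f) x (s⁻¹ • stepVec E j) (s⁻¹ • stepVec E j))
            * (E 0 j * E 0 j) = lap f x := by
        rw [hlap, ← hv2, Finset.mul_sum]
        refine Finset.sum_congr rfl fun j _ => ?_
        simp only [map_smul, _root_.smul_apply, smul_eq_mul]
        rw [← hss]
        field_simp
      rw [← h2]
      simp only [sub_mul _ _ (E 0 _ * E 0 _), Finset.sum_sub_distrib, h1, mul_assoc (1 / 2 : ℝ),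
        ← Finset.mul_sum]
      have h3 : ∀ g : Fin (n+1) → ℝ, ∑ j, g j * E 0 j ^ 2 = ∑ j, g j * (E 0 j * E 0 j) :=
        fun g => Finset.sum_congr rfl fun j _ => by ring
      rw [h3]
      simp only [sub_mul _ _ (E 0 _ * E 0 _), Finset.sum_sub_distrib, ← Finset.mul_sum]
      ring
    rw [hid, abs_mul, abs_of_pos hNr]
    calc _ ≤ (N:ℝ) * ∑ _j : Fin (n + 1), C * (s⁻¹ * B) ^ 3 := by
          refine mul_le_mul_of_nonneg_left ?_ hNr.le
          refine (Finset.abs_sum_le_sum_abs _ _).trans (Finset.sum_le_sum fun j _ => ?_)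
          rw [abs_mul]
          have h5 : C * ‖s⁻¹ • stepVec E j‖ ^ 3 ≤ C * (s⁻¹ * B) ^ 3 := by
            have := hnorm j
            gcongr
          have h6 := (hT j).2.trans h5
          calc _ ≤ C * (s⁻¹ * B) ^ 3 * 1 := by
                gcongr
                exact hw 0 0 j
            _ = _ := mul_one _
      _ = _ := by
          rw [hcard, ← hss]
          field_simp
  · intro k
    have hid : s * ∑ j, f (x + s⁻¹ • stepVec E j) * (E 0 j * E k.succ j)
          - fderiv ℝ f x (Pi.single k 1)
        = s * ∑ j, (f (x + s⁻¹ • stepVec E j) - f x - fderiv ℝ f x (s⁻¹ • stepVec E j))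
            * (E 0 j * E k.succ j) := by
      have h1 : s * ∑ j, fderiv ℝ f x (s⁻¹ • stepVec E j) * (E 0 j * E k.succ j)
          = fderiv ℝ f x (Pi.single k 1) := by
        rw [← hv1 k, map_sum, Finset.mul_sum]
        refine Finset.sum_congr rfl fun j _ => ?_
        simp only [map_smul, smul_eq_mul]
        field_simp
      rw [← h1]
      simp only [sub_mul _ _ (E 0 _ * E k.succ _), Finset.sum_sub_distrib, ← Finset.mul_sum, hrow,
        if_neg (Fin.succ_ne_zero k).symm]
      ring
    rw [hid, abs_mul, abs_of_pos hs]
    calc _ ≤ s * ∑ _j : Fin (n + 1), C * (s⁻¹ * B) ^ 2 := by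
          refine mul_le_mul_of_nonneg_left ?_ hs.le
          refine (Finset.abs_sum_le_sum_abs _ _).trans (Finset.sum_le_sum fun j _ => ?_)
          rw [abs_mul]
          have h5 : C * ‖s⁻¹ • stepVec E j‖ ^ 2 ≤ C * (s⁻¹ * B) ^ 2 := by
            have := hnorm j
            gcongr
          have h6 := (hT j).1.trans h5
          calc _ ≤ C * (s⁻¹ * B) ^ 2 * 1 := by
                gcongr
                exact hw 0 k.succ j
            _ = _ := mul_one _
      _ = (n + 1) * B ^ 2 * C / s := by
          rw [hcard]
          field_simp
      _ ≤ _ := by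
          have : B ^ 2 ≤ B ^ 3 := pow_le_pow_right₀ hB1 (by norm_num)
          gcongr

lemma He_grad_bound {n : ℕ} (f : (Fin n → ℝ) → ℝ) (C : ℝ) (x : Fin n → ℝ)
    (hC : ∀ i ≤ 3, ‖iteratedFDeriv ℝ i f x‖ ≤ C) (k : Fin n) :
    |fderiv ℝ f x (Pi.single k 1)| ≤ C := by
  have b1 : ‖fderiv ℝ f x‖ ≤ C := by
    have := hC 1 (by norm_num)
    rwa [← norm_iteratedFDeriv_fderiv, norm_iteratedFDeriv_zero] at this
  have h1 := (fderiv ℝ f x).le_opNorm (Pi.single k 1)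
  rw [Pi.norm_single, norm_one, mul_one] at h1
  exact h1.trans b1

lemma He_lap_bound {n : ℕ} (f : (Fin n → ℝ) → ℝ) (hf : ContDiff ℝ 3 f) (C : ℝ) (x : Fin n → ℝ)
    (hC : ∀ i ≤ 3, ‖iteratedFDeriv ℝ i f x‖ ≤ C) :
    |lap f x| ≤ n * C := by
  have b2 : ‖fderiv ℝ (fderiv ℝ f) x‖ ≤ C := by
    have := hC 2 (by norm_num)
    rwa [← norm_iteratedFDeriv_fderiv, ← norm_iteratedFDeriv_fderiv,
      norm_iteratedFDeriv_zero] at this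
  have hF1 : Differentiable ℝ (fderiv ℝ f) :=
    (hf.fderiv_right (m := 2) (by norm_num)).differentiable (by norm_num)
  unfold lap
  refine (Finset.abs_sum_le_sum_abs _ _).trans ?_
  calc _ ≤ ∑ _i : Fin n, C := by
        refine Finset.sum_le_sum fun i _ => ?_
        have e : fderiv ℝ (fun y => fderiv ℝ f y (Pi.single i 1)) x (Pi.single i 1)
            = fderiv ℝ (fderiv ℝ f) x (Pi.single i 1) (Pi.single i 1) := by
          rw [fderiv_clm_apply (hF1 x) (differentiableAt_const _)]
          simp
        rw [e]
        have h1 := (fderiv ℝ (fderiv ℝ f) x).le_opNorm₂ (Pi.single i 1) (Pi.single i 1)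
        rw [Pi.norm_single, norm_one, mul_one, mul_one] at h1
        exact h1.trans b2
    _ = _ := by simp

lemma He_time {X : Type*} (T : ℝ) (ν νt : ℝ → X → ℝ) (Ct L : ℝ)
    (hνt : ∀ t ∈ Set.Icc 0 T, ∀ x, HasDerivAt (fun s => ν s x) (νt t x) t)
    (hCt : ∀ t ∈ Set.Icc 0 T, ∀ x, |νt t x| ≤ Ct)
    (hL : ∀ s ∈ Set.Icc 0 T, ∀ t ∈ Set.Icc 0 T, ∀ x, |νt s x - νt t x| ≤ L * |s - t|)
    (t : ℝ) (ht : t ∈ Set.Icc 0 T) (t' : ℝ) (ht' : t' ∈ Set.Icc 0 T) (htt : t ≤ t') (x : X) :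
    |ν t' x - ν t x| ≤ Ct * (t' - t) ∧
    |ν t' x - ν t x - (t' - t) * νt t' x| ≤ |L| * (t' - t) ^ 2 := by
  have hsub : ∀ u ∈ Set.Icc t t', u ∈ Set.Icc 0 T := fun u hu =>
    ⟨ht.1.trans hu.1, hu.2.trans ht'.2⟩
  constructor
  · exact norm_image_sub_le_of_norm_deriv_le_segment' (f := fun s => ν s x)
      (fun u hu => (hνt u (hsub u hu) x).hasDerivWithinAt)
      (fun u hu => hCt u (hsub u ⟨hu.1, hu.2.le⟩) x) t' ⟨htt, le_rfl⟩
  · have := norm_image_sub_le_of_norm_deriv_le_segment' (f := fun s => ν s x - s * νt t' x)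
      (f' := fun s => νt s x - νt t' x) (C := |L| * (t' - t))
      (fun u hu => by
        have h1 := (hνt u (hsub u hu) x).sub ((hasDerivAt_id u).mul_const (νt t' x))
        exact (h1.congr_deriv (by simp)).hasDerivWithinAt)
      (fun u hu => by
        have h2 := hL u (hsub u ⟨hu.1, hu.2.le⟩) t' ht' x
        rw [Real.norm_eq_abs]
        refine h2.trans ?_
        have h3 : |u - t'| ≤ t' - t := by
          rw [abs_sub_comm, abs_of_nonneg (by linarith [hu.2])]; linarith [hu.1]
        exact mul_le_mul (le_abs_self L) h3 (abs_nonneg _) (abs_nonneg _)) t' ⟨htt, le_rfl⟩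
    rw [Real.norm_eq_abs] at this
    have e : ν t' x - ν t x - (t' - t) * νt t' x
        = (ν t' x - t' * νt t' x) - (ν t x - t * νt t' x) := by ring
    rw [e, sq, ← mul_assoc]
    exact this

/-- Order-`N^{-1/2}` convergence of He's discrete market prices: under no-arbitrage,
completeness, positive interest rate, order-`N^{-1/2}` approximation of the coefficients and
payoff, and existence of a regular bounded solution `ν` of the limit PDE
`∂ν/∂t + (1/2)Δν − ⟨b,∇ν⟩ − cν = 0`, `ν(T,·) = Φ`, the discrete prices `v^N` satisfy
`|ν(t,x) − v^N(t,x)| ≤ C N^{-1/2}` on the grid.  Grid times are `k/N`, `k ≤ M N := ⌊TN⌋`. -/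
theorem convergence_order_of_He_framework {n : ℕ} (hn : 1 ≤ n)
    (E : Matrix (Fin (n + 1)) (Fin (n + 1)) ℝ)
    (hE : E.transpose * E = 1) (hEpos : ∀ j, 0 < E 0 j)
    (T : ℝ) (hT : 0 < T) (M : ℕ → ℕ) (hM : ∀ N : ℕ, M N = Nat.floor (T * N))
    (h : ℕ → ℕ → (Fin n → ℝ) → Fin (n + 1) → ℝ)
    (ΦN : ℕ → (Fin n → ℝ) → ℝ) (v : ℕ → ℕ → (Fin n → ℝ) → ℝ)
    -- (i) no arbitrage and completeness
    (hinv : ∀ N : ℕ, 1 ≤ N → ∀ k ≤ M N, ∀ x, IsUnit (Hmat E N (h N k) x).det)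
    (hNA : ∀ N : ℕ, 1 ≤ N → ∀ k < M N, ∀ x, ∀ j,
        0 < Matrix.vecMul (h N k x) (Hmat E N (h N (k + 1)) x)⁻¹ j)
    -- (ii) positive interest rate: 0 < A < 1
    (hA : ∀ N : ℕ, 1 ≤ N → ∀ k < M N, ∀ x,
        0 < ∑ j, Matrix.vecMul (h N k x) (Hmat E N (h N (k + 1)) x)⁻¹ j ∧
          ∑ j, Matrix.vecMul (h N k x) (Hmat E N (h N (k + 1)) x)⁻¹ j < 1)
    -- (iii) bounded coefficients approximated at order N^{-1/2}
    (b : ℝ → (Fin n → ℝ) → Fin n → ℝ) (c : ℝ → (Fin n → ℝ) → ℝ) (Φ : (Fin n → ℝ) → ℝ)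
    (hbcΦbdd : ∃ C, ∀ t x, ‖b t x‖ ≤ C ∧ |c t x| ≤ C ∧ |Φ x| ≤ C)
    (hccont : Continuous fun q : ℝ × (Fin n → ℝ) => c q.1 q.2)
    (happrox : ∃ C, ∀ N : ℕ, 1 ≤ N →
        (∀ k, 1 ≤ k → k ≤ M N → ∀ x,
          Real.sqrt N *
            (‖(fun j : Fin n => b ((k : ℝ) / N) x j
                - driftCoeffs E N (h N (k - 1)) (h N k) x j.succ)‖
              + |c ((k : ℝ) / N) x - driftCoeffs E N (h N (k - 1)) (h N k) x 0|) ≤ C) ∧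
        ∀ x, Real.sqrt N * |Φ x - ΦN N x| ≤ C)
    -- (iv) regular bounded solution of the limit PDE
    (ν νt : ℝ → (Fin n → ℝ) → ℝ)
    (hνbdd : ∃ C, ∀ t ∈ Set.Icc 0 T, ∀ x, |ν t x| ≤ C)
    (hsp : ∀ t ∈ Set.Icc 0 T, ContDiff ℝ 3 (ν t))
    (hspb : ∃ C, ∀ i ≤ 3, ∀ t ∈ Set.Icc 0 T, ∀ x, ‖iteratedFDeriv ℝ i (ν t) x‖ ≤ C)
    (hνt : ∀ t ∈ Set.Icc 0 T, ∀ x, HasDerivAt (fun s => ν s x) (νt t x) t)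
    (hνtb : ∃ C, ∀ t ∈ Set.Icc 0 T, ∀ x, |νt t x| ≤ C)
    (hνtLip : ∃ L, ∀ s ∈ Set.Icc 0 T, ∀ t ∈ Set.Icc 0 T, ∀ x,
        |νt s x - νt t x| ≤ L * |s - t|)
    (hPDE : ∀ t, 0 ≤ t → t < T → ∀ x,
        νt t x + (1 / 2) * lap (ν t) x
          - (∑ k : Fin n, b t x k * fderiv ℝ (ν t) x (Pi.single k 1))
          - c t x * ν t x = 0)
    (hterm : ∀ x, ν T x = Φ x)
    -- the discrete pricing recursion
    (hvterm : ∀ N : ℕ, 1 ≤ N → ∀ x, v N (M N) x = ΦN N x)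
    (hvrec : ∀ N : ℕ, 1 ≤ N → ∀ k < M N, ∀ x, v N k x =
        ∑ i, Matrix.vecMul (h N k x) (Hmat E N (h N (k + 1)) x)⁻¹ i
          * v N (k + 1) (x + (Real.sqrt N)⁻¹ • stepVec E i)) :
    ∃ C, ∀ N : ℕ, 1 ≤ N → ∀ k ≤ M N, ∀ x,
      |ν ((k : ℝ) / N) x - v N k x| ≤ C / Real.sqrt N := by
  obtain ⟨K, hK0, hK⟩ := He_ops E hE hEpos
  obtain ⟨Cb, hCb⟩ := hbcΦbdd
  obtain ⟨Ca, hCa⟩ := happrox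
  obtain ⟨Cν, hCν⟩ := hνbdd
  obtain ⟨Cs, hCs⟩ := hspb
  obtain ⟨Ct, hCt⟩ := hνtb
  obtain ⟨L, hL⟩ := hνtLip
  have h0T : (0:ℝ) ∈ Set.Icc 0 T := ⟨le_rfl, hT.le⟩
  have hCb0 : 0 ≤ Cb := (abs_nonneg _).trans (hCb 0 0).2.1
  have hCν0 : 0 ≤ Cν := (abs_nonneg _).trans (hCν 0 h0T 0)
  have hCs0 : 0 ≤ Cs := (norm_nonneg _).trans (hCs 0 (by norm_num) 0 h0T 0)
  have hCt0 : 0 ≤ Ct := (abs_nonneg _).trans (hCt 0 h0T 0)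
  have hCa0 : 0 ≤ Ca := (mul_nonneg (Real.sqrt_nonneg _) (abs_nonneg _)).trans
    ((hCa 1 le_rfl).2 0)
  have hEE : E * E.transpose = 1 := mul_eq_one_comm.mp hE
  have hrow : ∀ a b, ∑ j, E a j * E b j = if a = b then 1 else 0 := by
    intro a b
    have := congrFun (congrFun hEE a) b
    simpa [Matrix.mul_apply, Matrix.one_apply] using this
  set P : ℝ := |L| + K * Cs + n * (Ca * (Cs + K * Cs) + Cb * (K * Cs)) + (Ca * Cν + Cb * Ct)
    with hP
  set R : ℝ := Ct + (1 / 2) * (n * Cs) + n * (Cb * Cs) + Cb * Cν with hR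
  have hP0 : 0 ≤ P := by positivity
  have hR0 : 0 ≤ R := by positivity
  let r : ℝ → (Fin n → ℝ) → ℝ := fun t x => νt t x + (1 / 2) * lap (ν t) x
          - (∑ k : Fin n, b t x k * fderiv ℝ (ν t) x (Pi.single k 1)) - c t x * ν t x
  have hgrad : ∀ t ∈ Set.Icc 0 T, ∀ x, ∀ k, |fderiv ℝ (ν t) x (Pi.single k 1)| ≤ Cs :=
    fun t ht x k => He_grad_bound _ _ x (fun i hi => hCs i hi t ht x) k
  have hrR : ∀ t ∈ Set.Icc 0 T, ∀ x, |r t x| ≤ R := by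
    intro t ht x
    have h1 := hCt t ht x
    have h2 := He_lap_bound (ν t) (hsp t ht) Cs x (fun i hi => hCs i hi t ht x)
    have h3 : |∑ k : Fin n, b t x k * fderiv ℝ (ν t) x (Pi.single k 1)| ≤ n * (Cb * Cs) := by
      refine (Finset.abs_sum_le_sum_abs _ _).trans ?_
      calc _ ≤ ∑ _k : Fin n, Cb * Cs := by
            refine Finset.sum_le_sum fun k _ => ?_
            rw [abs_mul]
            exact mul_le_mul ((norm_le_pi_norm (b t x) k).trans (hCb t x).1) (hgrad t ht x k)
              (abs_nonneg _) hCb0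
        _ = _ := by simp
    have h4 : |c t x * ν t x| ≤ Cb * Cν := by
      rw [abs_mul]; exact mul_le_mul (hCb t x).2.1 (hCν t ht x) (abs_nonneg _) hCb0
    simp only [r, hR]
    rw [abs_le] at *
    constructor <;> linarith [h1.1, h1.2, h2.1, h2.2, h3.1, h3.2, h4.1, h4.2]
  refine ⟨(Ct + Ca) + R + T * P, ?_⟩
  intro N hN
  have hNr : (0:ℝ) < N := by exact_mod_cast hN
  have hN1 : (1:ℝ) ≤ N := by exact_mod_cast hN
  have hs : 0 < Real.sqrt N := Real.sqrt_pos.mpr hNr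
  have hss : Real.sqrt N * Real.sqrt N = N := Real.mul_self_sqrt hNr.le
  have hs1 : 1 ≤ Real.sqrt N := Real.one_le_sqrt.mpr hN1
  have hsN : 1 / (N:ℝ) ≤ 1 / Real.sqrt N := one_div_le_one_div_of_le hs (by nlinarith)
  have hMT : (M N : ℝ) ≤ T * N := by rw [hM]; exact Nat.floor_le (by positivity)
  have hMT' : T * N < M N + 1 := by rw [hM]; exact Nat.lt_floor_add_one _
  have hgrid : ∀ k ≤ M N, (k:ℝ) / N ∈ Set.Icc 0 T := by
    intro k hk
    refine ⟨by positivity, ?_⟩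
    rw [div_le_iff₀ hNr]
    have : (k:ℝ) ≤ M N := by exact_mod_cast hk
    linarith
  set s := Real.sqrt N with hsdef
  have base : ∀ x, |ν ((M N : ℝ) / N) x - v N (M N) x| ≤ (Ct + Ca) / s := by
    intro x
    rw [hvterm N hN]
    have h1 := (He_time T ν νt Ct L hνt hCt hL _ (hgrid _ le_rfl) T ⟨hT.le, le_rfl⟩
      (hgrid _ le_rfl).2 x).1
    rw [hterm] at h1
    have h2 : |Φ x - ΦN N x| ≤ Ca / s := by
      rw [le_div_iff₀ hs, mul_comm]; exact (hCa N hN).2 x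
    have h3 : T - (M N : ℝ) / N ≤ 1 / N := by
      rw [sub_le_iff_le_add, ← add_div, le_div_iff₀ hNr]; linarith
    have h4 : Ct * (T - (M N : ℝ) / N) ≤ Ct / s := by
      rw [div_eq_mul_one_div Ct s]
      exact mul_le_mul_of_nonneg_left (h3.trans hsN) hCt0
    rw [add_div]
    rw [abs_le] at *
    constructor <;> linarith [h1.1, h1.2, h2.1, h2.2]
  have step : ∀ k < M N, ∀ Bd ρ : ℝ, 
      (∀ x, |ν (((k + 1 : ℕ) : ℝ) / N) x - v N (k + 1) x| ≤ Bd) →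
      (∀ x, |r (((k + 1 : ℕ) : ℝ) / N) x| ≤ ρ) →
      ∀ x, |ν ((k : ℝ) / N) x - v N k x| ≤ Bd + (P / s + ρ) / N := by
    intro k hk Bd ρ hBd hρ x
    have hBd0 : 0 ≤ Bd := (abs_nonneg _).trans (hBd x)
    have ht' := hgrid (k + 1) hk
    have ht := hgrid k hk.le
    have hdt : ((k + 1 : ℕ) : ℝ) / N - (k:ℝ) / N = 1 / N := by push_cast; ring
    set t' := ((k + 1 : ℕ) : ℝ) / N with ht'def
    set t := (k : ℝ) / N with htdef
    have htt : t ≤ t' := by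
      have : 0 < 1 / (N:ℝ) := by positivity
      linarith
    have hq := He_weights E hE hEpos N hN (h N k) (h N (k + 1)) x (hinv N hN (k + 1) hk x)
      (hA N hN k hk x).1
    have hqpos := hNA N hN k hk x
    have hAA := hA N hN k hk x
    have happ := (hCa N hN).1 (k + 1) (by omega) hk x
    rw [Nat.add_sub_cancel, ← ht'def] at happ
    rw [hvrec N hN k hk x]
    set q := Matrix.vecMul (h N k x) (Hmat E N (h N (k + 1)) x)⁻¹ with hqdef
    set d := driftCoeffs E N (h N k) (h N (k + 1)) x with hd
    have hsumq : (N + d 0) * ∑ j, q j = N := by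
      rw [Finset.mul_sum]
      simp only [hq, Finset.sum_sub_distrib, ← Finset.mul_sum]
      rw [Finset.sum_comm]
      simp only [← Finset.mul_sum, hrow, sq]
      simp [(Fin.succ_ne_zero _).symm]
    have hD : (N:ℝ) ≤ N + d 0 := by
      by_contra hcon
      push Not at hcon
      nlinarith [hAA.1, hAA.2]
    have hDpos : 0 < N + d 0 := hNr.trans_le hD
    have hap := He_apply E hE N (d 0) (fun k => d k.succ) q hq (ν t') x
    rw [← hsdef] at hap
    have happ' : ‖(fun j : Fin n => b t' x j - d j.succ)‖ + |c t' x - d 0| ≤ Ca / s := by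
      rw [le_div_iff₀ hs, mul_comm]; exact happ
    have hbβ : ∀ j : Fin n, |b t' x j - d j.succ| ≤ Ca / s := by
      intro j
      have := norm_le_pi_norm (fun j : Fin n => b t' x j - d j.succ) j
      rw [Real.norm_eq_abs] at this
      have h2 := abs_nonneg (c t' x - d 0)
      linarith
    have hcd : |c t' x - d 0| ≤ Ca / s := by
      have := norm_nonneg (fun j : Fin n => b t' x j - d j.succ)
      linarith
    obtain ⟨htm1, htm2⟩ := He_time T ν νt Ct L hνt hCt hL t ht t' ht' htt x
    rw [hdt] at htm1 htm2
    obtain ⟨hlapK, hgrK⟩ := hK Cs (ν t') (hsp t' ht') (fun i hi x => hCs i hi t' ht' x) N hN x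
    rw [← hsdef] at hlapK hgrK
    have B1 : |N * (ν t' x - ν t x) - νt t' x| ≤ |L| / s := by
      have e : N * (ν t' x - ν t x) - νt t' x = N * (ν t' x - ν t x - 1 / N * νt t' x) := by
        field_simp
      rw [e, abs_mul, abs_of_pos hNr]
      calc _ ≤ N * (|L| * (1 / N) ^ 2) := by gcongr
        _ = |L| * (1 / N) := by field_simp
        _ ≤ |L| * (1 / s) := by gcongr
        _ = _ := by ring
    have B3 : |∑ k : Fin n, (d k.succ * dpartial E N k (ν t') x
          - b t' x k * fderiv ℝ (ν t') x (Pi.single k 1))|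
        ≤ n * (Ca * (Cs + K * Cs) + Cb * (K * Cs)) / s := by
      refine (Finset.abs_sum_le_sum_abs _ _).trans ?_
      calc _ ≤ ∑ _k : Fin n, (Ca / s * (Cs + K * Cs) + Cb * (K * Cs / s)) := by
            refine Finset.sum_le_sum fun k _ => ?_
            have e : d k.succ * dpartial E N k (ν t') x
                - b t' x k * fderiv ℝ (ν t') x (Pi.single k 1)
                = -(b t' x k - d k.succ) * dpartial E N k (ν t') x
                + b t' x k * (dpartial E N k (ν t') x - fderiv ℝ (ν t') x (Pi.single k 1)) := by
              ring
            rw [e]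
            refine (abs_add_le _ _).trans ?_
            rw [abs_mul, abs_mul, abs_neg]
            have g1 := hgrK k
            have g2 := hgrad t' ht' x k
            have g3 : K * Cs / s ≤ K * Cs := div_le_self (by positivity) hs1
            have g4 : |dpartial E N k (ν t') x| ≤ Cs + K * Cs := by
              rw [abs_le] at *
              constructor <;> linarith [g1.1, g1.2, g2.1, g2.2]
            have g5 : |b t' x k| ≤ Cb := (norm_le_pi_norm (b t' x) k).trans (hCb t' x).1
            exact add_le_add
              (mul_le_mul (hbβ k) g4 (abs_nonneg _) (by positivity))
              (mul_le_mul g5 g1 (abs_nonneg _) hCb0)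
        _ = _ := by
          simp only [Finset.sum_const, Finset.card_univ, Fintype.card_fin, nsmul_eq_mul]
          ring
    have B4 : |d 0 * ν t x - c t' x * ν t' x| ≤ (Ca * Cν + Cb * Ct) / s := by
      have e : d 0 * ν t x - c t' x * ν t' x
          = -(c t' x - d 0) * ν t x + -(c t' x) * (ν t' x - ν t x) := by ring
      rw [e]
      refine (abs_add_le _ _).trans ?_
      rw [abs_mul, abs_mul, abs_neg, abs_neg]
      have g1 := mul_le_mul hcd (hCν t ht x) (abs_nonneg _) (by positivity)
      have g2 := mul_le_mul (hCb t' x).2.1 htm1 (abs_nonneg _) hCb0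
      have g3 : Cb * (Ct * (1 / N)) ≤ Cb * (Ct * (1 / s)) := by gcongr
      calc _ ≤ Ca / s * Cν + Cb * (Ct * (1 / s)) := by linarith
        _ = _ := by ring
    have hτ : |(N + d 0) * (ν t x - ∑ j, q j * ν t' (x + s⁻¹ • stepVec E j))| ≤ P / s + ρ := by
      have e : (N + d 0) * (ν t x - ∑ j, q j * ν t' (x + s⁻¹ • stepVec E j))
          = -(N * (ν t' x - ν t x) - νt t' x)
            - ((1 / 2) * dlap E N (ν t') x - (1 / 2) * lap (ν t') x)
            + (∑ k : Fin n, (d k.succ * dpartial E N k (ν t') x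
              - b t' x k * fderiv ℝ (ν t') x (Pi.single k 1)))
            + (d 0 * ν t x - c t' x * ν t' x) - r t' x := by
        rw [mul_sub, hap, Finset.sum_sub_distrib]
        simp only [r]
        ring
      rw [e]
      have B5 := hρ x
      have eP : P / s = |L| / s + K * Cs / s
          + n * (Ca * (Cs + K * Cs) + Cb * (K * Cs)) / s + (Ca * Cν + Cb * Ct) / s := by
        rw [hP]; ring
      rw [eP]
      clear_value P r
      rw [abs_le] at B1 hlapK B3 B4 B5 ⊢
      constructor <;> linarith [B1.1, B1.2, hlapK.1, hlapK.2, B3.1, B3.2, B4.1, B4.2, B5.1, B5.2]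
    have hρ0 : 0 ≤ ρ := (abs_nonneg _).trans (hρ x)
    have hτ' : |ν t x - ∑ j, q j * ν t' (x + s⁻¹ • stepVec E j)| ≤ (P / s + ρ) / N := by
      rw [le_div_iff₀ hNr, mul_comm]
      rw [abs_mul, abs_of_pos hDpos] at hτ
      exact (mul_le_mul_of_nonneg_right hD (abs_nonneg _)).trans hτ
    have herr : |∑ j, q j * (ν t' (x + s⁻¹ • stepVec E j)
        - v N (k + 1) (x + s⁻¹ • stepVec E j))| ≤ Bd := by
      refine (Finset.abs_sum_le_sum_abs _ _).trans ?_
      calc _ ≤ ∑ j, q j * Bd := by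
            refine Finset.sum_le_sum fun j _ => ?_
            rw [abs_mul, abs_of_pos (hqpos j)]
            exact mul_le_mul_of_nonneg_left (hBd _) (hqpos j).le
        _ = (∑ j, q j) * Bd := by rw [Finset.sum_mul]
        _ ≤ 1 * Bd := mul_le_mul_of_nonneg_right hAA.2.le hBd0
        _ = Bd := one_mul _
    have e : ν t x - ∑ i, q i * v N (k + 1) (x + s⁻¹ • stepVec E i)
        = (∑ j, q j * (ν t' (x + s⁻¹ • stepVec E j) - v N (k + 1) (x + s⁻¹ • stepVec E j)))
          + (ν t x - ∑ j, q j * ν t' (x + s⁻¹ • stepVec E j)) := by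
      simp only [mul_sub, Finset.sum_sub_distrib]; ring
    rw [e]
    exact (abs_add_le _ _).trans (add_le_add herr hτ')
  have main : ∀ m k : ℕ, k + m = M N → ∀ x, |ν ((k : ℝ) / N) x - v N k x|
      ≤ (Ct + Ca) / s + (if m = 0 then 0 else R / N) + m * (P / s / N) := by
    intro m
    induction m with
    | zero =>
      intro k hk x
      have : k = M N := by omega
      subst this
      simpa using base x
    | succ m ih =>
      intro k hk x
      have hk1 : k < M N := by omega
      by_cases hm : m = 0
      · subst hm
        have := step k hk1 _ R (ih (k + 1) (by omega)) (hrR _ (hgrid (k + 1) hk1)) x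
        refine this.trans (le_of_eq ?_)
        simp
        ring
      · have hr0 : ∀ x, |r (((k + 1 : ℕ) : ℝ) / N) x| ≤ 0 := by
          intro x
          have hlt : ((k + 1 : ℕ) : ℝ) / N < T := by
            rw [div_lt_iff₀ hNr]
            have : ((k + 1 : ℕ) : ℝ) < M N := by exact_mod_cast (by omega : k + 1 < M N)
            linarith
          have := hPDE _ (hgrid (k + 1) hk1).1 hlt x
          simp only [r]
          rw [this, abs_zero]
        have := step k hk1 _ 0 (ih (k + 1) (by omega)) hr0 x
        refine this.trans (le_of_eq ?_)
        rw [if_neg hm, if_neg (Nat.succ_ne_zero m)]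
        push_cast
        ring
  intro k hk x
  refine (main (M N - k) k (by omega) x).trans ?_
  have h1 : (if M N - k = 0 then 0 else R / (N:ℝ)) ≤ R / s := by
    split_ifs
    · positivity
    · rw [div_eq_mul_one_div, div_eq_mul_one_div R s]; gcongr
  have h2 : ((M N - k : ℕ) : ℝ) ≤ T * N := by
    have : ((M N - k : ℕ) : ℝ) ≤ M N := by exact_mod_cast Nat.sub_le _ _
    linarith
  have h3 : ((M N - k : ℕ) : ℝ) * (P / s / N) ≤ T * P / s := by
    calc _ ≤ T * N * (P / s / N) := by gcongr
      _ = _ := by field_simp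
  have h4 : (Ct + Ca + R + T * P) / s = (Ct + Ca) / s + R / s + T * P / s := by ring
  rw [h4]
  exact add_le_add (add_le_add le_rfl h1) h3
end

section
/- (Order-N^{-1} convergence in dimension one for the symmetric walk.) Let n = 1 and consider the symmetric binomial case e_0 = 1, e_1 = −1 with e_{0,0} = e_{0,1} = 1/√2, so that ∂^N f(x) = √N (f(x+N^{-1/2}) − f(x−N^{-1/2}))/2 and Δ^N f(x) = N (f(x+N^{-1/2}) + f(x−N^{-1/2}) − 2f(x)). Assume conditions (i) and (ii) of the convergence theorem (no-arbitrage, completeness, and 0 < A < 1), that the approximation bounds hold at order N^{-1}, i.e. sup_N sup_{(t,x)} N ( |b − b^N| + |c − c^N| + |Φ − Φ^N| ) < ∞, and that the PDE ∂ν/∂t + (1/2)ν'' − b ν' − c ν = 0, ν(T,·) = Φ, has a bounded solution ν which is C^{2,4} with all spatial derivatives up to order 4 bounded and time derivatives up to order 2 bounded. Then there is a constant C such that for all N ≥ 1 and all (t,x) ∈ [0,T]_N × ℝ: |ν(t,x) − v^N(t,x)| ≤ C N^{-1}, where v^N solves the backward pricing recursion v^N(T_N,x) = Φ^N(x), v^N(t,x)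 = h^N(t,x) H^N(t+N^{-1},x)^{-1} (v^N(t+N^{-1}, x+N^{-1/2}),v^N(t+N^{-1}, x−N^{-1/2}))^T. -/
/-- The step `±1` of the one-dimensional symmetric walk: `e_0 = 1`, `e_1 = −1`. -/
def sgn1 (i : Fin 2) : ℝ := if i = 0 then 1 else -1

/-- One-dimensional discrete derivative `∂^N f(x) = √N (f(x+N^{-1/2}) − f(x−N^{-1/2}))/2`. -/
noncomputable def dp1 (N : ℕ) (f : ℝ → ℝ) (x : ℝ) : ℝ :=
  Real.sqrt N * (f (x + (Real.sqrt N)⁻¹) - f (x - (Real.sqrt N)⁻¹)) / 2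

/-- One-dimensional discrete Laplacian
`Δ^N f(x) = N (f(x+N^{-1/2}) + f(x−N^{-1/2}) − 2f(x))`. -/
noncomputable def dl1 (N : ℕ) (f : ℝ → ℝ) (x : ℝ) : ℝ :=
  N * (f (x + (Real.sqrt N)⁻¹) + f (x - (Real.sqrt N)⁻¹) - 2 * f x)

/-- The `2×2` price matrix `H^N(t,x)` with rows `h^N(t, x ± N^{-1/2})`. -/
noncomputable def Hmat1 (N : ℕ) (hk : ℝ → Fin 2 → ℝ) (x : ℝ) : Matrix (Fin 2) (Fin 2) ℝ :=
  Matrix.of fun i j => hk (x + (Real.sqrt N)⁻¹ * sgn1 i) j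

/-- The `2×2` volatility matrix `Σ^N(t,x)`: first row `h^N(t−N⁻¹,x)`, second row the discrete
derivative of the price functions at time `t`. -/
noncomputable def Sig1 (N : ℕ) (hprev hcur : ℝ → Fin 2 → ℝ) (x : ℝ) :
    Matrix (Fin 2) (Fin 2) ℝ :=
  Matrix.of fun r c => if r = 0 then hprev x c else dp1 N (fun y => hcur y c) x

/-- The row vector `(c^N, b^N) = (∂^N_t h^N + (1/2)Δ^N h^N)(Σ^N)⁻¹`. -/
noncomputable def coeffs1 (N : ℕ) (hprev hcur : ℝ → Fin 2 → ℝ) (x : ℝ) : Fin 2 → ℝ :=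
  Matrix.vecMul
    (fun c => (N : ℝ) * (hcur x c - hprev x c) + (1 / 2) * dl1 N (fun y => hcur y c) x)
    (Sig1 N hprev hcur x)⁻¹

theorem aux_int {g g' : ℝ → ℝ} {C s : ℝ} (n : ℕ) (hC : 0 ≤ C) (h0 : g 0 = 0)
    (hd : ∀ r, HasDerivAt g (g' r) r) (hb : ∀ r, 0 ≤ r → |g' r| ≤ C * r ^ n)
    (hs : 0 ≤ s) : |g s| ≤ C * s ^ (n + 1) := by
  have := norm_image_sub_le_of_norm_deriv_le_segment' (f := g) (f' := g') (C := C * s ^ n)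
    (a := 0) (b := s) (fun x _ => (hd x).hasDerivWithinAt)
    (fun x hx => by
      rw [Real.norm_eq_abs]
      refine (hb x hx.1).trans ?_
      have := pow_le_pow_left₀ hx.1 hx.2.le n
      gcongr) s ⟨hs, le_rfl⟩
  rw [h0, Real.norm_eq_abs] at this
  simp only [sub_zero] at this
  rw [pow_succ, ← mul_assoc]; exact this

theorem aux_shift {f f' : ℝ → ℝ} (hd : ∀ y, HasDerivAt f (f' y) y) (x r : ℝ) :
    HasDerivAt (fun r => f (x + r)) (f' (x + r)) r ∧
    HasDerivAt (fun r => f (x - r)) (-f' (x - r)) r := by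
  constructor
  · exact ((hd (x + r)).comp r ((hasDerivAt_id r).const_add x)).congr_deriv (by simp)
  · exact ((hd (x - r)).comp r ((hasDerivAt_id r).const_sub x)).congr_deriv (by simp)

theorem aux_first {f0 f1 f2 f3 : ℝ → ℝ} {K : ℝ} (hK : 0 ≤ K)
    (d0 : ∀ y, HasDerivAt f0 (f1 y) y) (d1 : ∀ y, HasDerivAt f1 (f2 y) y)
    (d2 : ∀ y, HasDerivAt f2 (f3 y) y) (hb : ∀ y, |f3 y| ≤ K) (x s : ℝ) (hs : 0 ≤ s) :
    |f0 (x + s) - f0 (x - s) - 2 * s * f1 x| ≤ 2 * K * s ^ 3 := by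
  have K2 : 0 ≤ 2 * K := by linarith
  have e2 : ∀ r, 0 ≤ r → |f2 (x + r) - f2 (x - r)| ≤ 2 * K * r ^ 1 := fun r hr =>
    aux_int (g := fun r => f2 (x + r) - f2 (x - r)) (g' := fun r => f3 (x + r) + f3 (x - r))
      0 K2 (by simp)
      (fun r => by
        have := (aux_shift d2 x r).1.sub (aux_shift d2 x r).2
        exact this.congr_deriv (by ring))
      (fun r _ => by
        have := abs_add_le (f3 (x + r)) (f3 (x - r))
        have := hb (x + r); have := hb (x - r); simp only [pow_zero]; linarith) hr
  have e1 : ∀ r, 0 ≤ r → |f1 (x + r) + f1 (x - r) - 2 * f1 x| ≤ 2 * K * r ^ 2 := fun r hr =>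
    aux_int (g := fun r => f1 (x + r) + f1 (x - r) - 2 * f1 x)
      (g' := fun r => f2 (x + r) - f2 (x - r))
      1 K2 (by simp; ring)
      (fun r => by
        have := ((aux_shift d1 x r).1.add (aux_shift d1 x r).2).sub_const (2 * f1 x)
        exact this.congr_deriv (by ring)) e2 hr
  exact aux_int (g := fun r => f0 (x + r) - f0 (x - r) - 2 * r * f1 x)
      (g' := fun r => f1 (x + r) + f1 (x - r) - 2 * f1 x)
      2 K2 (by simp)
      (fun r => by
        have := ((aux_shift d0 x r).1.sub (aux_shift d0 x r).2).sub
          (((hasDerivAt_id r).const_mul 2).mul_const (f1 x))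
        exact this.congr_deriv (by ring)) e1 hs

theorem aux_second {f0 f1 f2 f3 f4 : ℝ → ℝ} {K : ℝ} (hK : 0 ≤ K)
    (d0 : ∀ y, HasDerivAt f0 (f1 y) y) (d1 : ∀ y, HasDerivAt f1 (f2 y) y)
    (d2 : ∀ y, HasDerivAt f2 (f3 y) y) (d3 : ∀ y, HasDerivAt f3 (f4 y) y)
    (hb : ∀ y, |f4 y| ≤ K) (x s : ℝ) (hs : 0 ≤ s) :
    |f0 (x + s) + f0 (x - s) - 2 * f0 x - s ^ 2 * f2 x| ≤ 2 * K * s ^ 4 := by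
  have K2 : 0 ≤ 2 * K := by linarith
  exact aux_int (g := fun r => f0 (x + r) + f0 (x - r) - 2 * f0 x - r ^ 2 * f2 x)
      (g' := fun r => f1 (x + r) - f1 (x - r) - 2 * r * f2 x)
      3 K2 (by simp; ring)
      (fun r => by
        have := (((aux_shift d0 x r).1.add (aux_shift d0 x r).2).sub_const (2 * f0 x)).sub
          ((hasDerivAt_pow 2 r).mul_const (f2 x))
        exact this.congr_deriv (by push_cast; ring))
      (fun r hr => aux_first hK d1 d2 d3 hb x r hr) hs

theorem aux_spatial {f : ℝ → ℝ} {K : ℝ} (hf : ContDiff ℝ 4 f)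
    (hb : ∀ i ≤ 4, ∀ x, |iteratedDeriv i f x| ≤ K) (N : ℕ) (hN : 1 ≤ N) (x : ℝ) :
    |dp1 N f x - deriv f x| ≤ K / N ∧ |dl1 N f x - deriv (deriv f) x| ≤ 2 * K / N := by
  have hK : 0 ≤ K := (abs_nonneg _).trans (hb 0 (by norm_num) 0)
  have d : ∀ i < 4, ∀ y, HasDerivAt (iteratedDeriv i f) (iteratedDeriv (i + 1) f y) y := by
    intro i hi y
    rw [iteratedDeriv_succ]
    exact ((hf.differentiable_iteratedDeriv i (by exact_mod_cast hi)) y).hasDerivAt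
  have hN0 : (0 : ℝ) < N := by exact_mod_cast hN
  have hs0 : 0 < Real.sqrt N := Real.sqrt_pos.2 hN0
  have hsq : Real.sqrt N * Real.sqrt N = N := Real.mul_self_sqrt hN0.le
  have h1 := aux_first hK (d 0 (by norm_num)) (d 1 (by norm_num)) (d 2 (by norm_num))
    (hb 3 (by norm_num)) x (Real.sqrt N)⁻¹ (by positivity)
  have h2 := aux_second hK (d 0 (by norm_num)) (d 1 (by norm_num)) (d 2 (by norm_num))
    (d 3 (by norm_num)) (hb 4 (by norm_num)) x (Real.sqrt N)⁻¹ (by positivity)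
  have i1 : iteratedDeriv 1 f = deriv f := iteratedDeriv_one
  have i2 : iteratedDeriv 2 f = deriv (deriv f) := by
    rw [iteratedDeriv_succ, i1]
  simp only [iteratedDeriv_zero, zero_add, one_add_one_eq_two] at h1 h2
  rw [i1] at h1
  rw [i2] at h2
  generalize hσ : Real.sqrt N = σ at *
  constructor
  · have : dp1 N f x - deriv f x
        = σ / 2 * (f (x + σ⁻¹) - f (x - σ⁻¹) - 2 * σ⁻¹ * deriv f x) := by
      rw [dp1, hσ]; field_simp
    rw [this, abs_mul, abs_of_pos (by positivity : 0 < σ / 2)]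
    refine (mul_le_mul_of_nonneg_left h1 (by positivity)).trans (le_of_eq ?_)
    rw [← hsq]; field_simp
  · have : dl1 N f x - deriv (deriv f) x
        = σ * σ * (f (x + σ⁻¹) + f (x - σ⁻¹) - 2 * f x - σ⁻¹ ^ 2 * deriv (deriv f) x) := by
      rw [dl1, hσ, ← hsq]; field_simp
    rw [this, abs_mul, abs_of_pos (by positivity : 0 < σ * σ)]
    refine (mul_le_mul_of_nonneg_left h2 (by positivity)).trans (le_of_eq ?_)
    rw [← hsq]; field_simp

theorem aux_coeff (N : ℕ) (hN : 1 ≤ N) (hp hc : ℝ → Fin 2 → ℝ) (x : ℝ)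
    (hdet : IsUnit (Hmat1 N hc x).det) (p q : ℝ)
    (hpw : Matrix.vecMul (hp x) (Hmat1 N hc x)⁻¹ 0 = p)
    (hqw : Matrix.vecMul (hp x) (Hmat1 N hc x)⁻¹ 1 = q) (ha : 0 < p + q) :
    (p + q) * coeffs1 N hp hc x 0 = N * (1 - (p + q)) ∧
    (p + q) * coeffs1 N hp hc x 1 = - ((p - q) * Real.sqrt N) := by
  have hN0 : (0 : ℝ) < N := by exact_mod_cast hN
  have hs0 : 0 < Real.sqrt N := Real.sqrt_pos.2 hN0
  have hsq : Real.sqrt N * Real.sqrt N = N := Real.mul_self_sqrt hN0.le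
  have hw : Matrix.vecMul (hp x) (Hmat1 N hc x)⁻¹ = ![p, q] := by
    ext i; fin_cases i <;> simp [hpw, hqw]
  have hpx : hp x = Matrix.vecMul ![p, q] (Hmat1 N hc x) := by
    rw [← hw, Matrix.vecMul_vecMul, Matrix.nonsing_inv_mul _ hdet, Matrix.vecMul_one]
  have hpj : ∀ j, hp x j = p * hc (x + (Real.sqrt N)⁻¹) j + q * hc (x - (Real.sqrt N)⁻¹) j := by
    intro j
    rw [hpx]
    simp [Matrix.vecMul, dotProduct, Fin.sum_univ_two, Hmat1, sgn1, sub_eq_add_neg]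
  have hdet' : (Hmat1 N hc x).det ≠ 0 := hdet.ne_zero
  rw [Matrix.det_fin_two] at hdet'
  simp [Hmat1, sgn1, ← sub_eq_add_neg] at hdet'
  have hS : IsUnit (Sig1 N hp hc x).det := by
    rw [isUnit_iff_ne_zero, Matrix.det_fin_two]
    simp only [Sig1, Matrix.of_apply, if_true, one_ne_zero, if_false, hpj, dp1]
    intro h0
    apply hdet'
    have : (p + q) * Real.sqrt N ≠ 0 := by positivity
    apply mul_left_cancel₀ this
    linear_combination (-2) * h0
  set a := p + q with hadef
  have key : coeffs1 N hp hc x = ![N * (1 - a) / a, - ((p - q) * Real.sqrt N) / a] := by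
    rw [coeffs1]
    have : (fun c => (N : ℝ) * (hc x c - hp x c) + (1 / 2) * dl1 N (fun y => hc y c) x)
        = Matrix.vecMul ![N * (1 - a) / a, - ((p - q) * Real.sqrt N) / a]
            (Sig1 N hp hc x) := by
      ext j
      simp only [Matrix.vecMul, dotProduct, Fin.sum_univ_two, Sig1, Matrix.of_apply, if_true,
        one_ne_zero, if_false, hpj, dp1, dl1, Matrix.cons_val_zero, Matrix.cons_val_one]
      have ha0 : a ≠ 0 := ha.ne'
      generalize hc (x + (Real.sqrt N)⁻¹) j = X at *
      generalize hc (x - (Real.sqrt N)⁻¹) j = Y at *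
      generalize hc x j = Z at *
      obtain ⟨σ, hσ⟩ : ∃ σ, σ = Real.sqrt N := ⟨_, rfl⟩
      rw [← hσ] at hsq ⊢
      rw [← hsq]
      field_simp
      rw [hadef]
      ring
    rw [this, Matrix.vecMul_vecMul, Matrix.mul_nonsing_inv _ hS, Matrix.vecMul_one]
  rw [key]
  constructor
  · simp only [Matrix.cons_val_zero]; field_simp
  · simp only [Matrix.cons_val_one, Matrix.cons_val_zero]; field_simp

theorem aux_step {n K p q σ u0 u up um cN bN c b f1 f2 vt : ℝ} (hn : 1 ≤ n) (hK : 0 ≤ K)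
    (hsq : σ * σ = n)
    (ha : 0 < p + q) (ha1 : p + q < 1)
    (hc : (p + q) * cN = n * (1 - (p + q))) (hb : (p + q) * bN = -((p - q) * σ))
    (hbn : |b - bN| ≤ K / n) (hcn : |c - cN| ≤ K / n)
    (hB : |b| ≤ K) (hC : |c| ≤ K) (hu0 : |u0| ≤ K) (hf1 : |f1| ≤ K)
    (h1 : |σ * (up - um) / 2 - f1| ≤ K / n) (h2 : |n * (up + um - 2 * u) - f2| ≤ 2 * K / n)
    (ht1 : |u0 - u| ≤ K / n) (ht2 : |n * (u0 - u) + vt| ≤ K / n) :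
    |u0 - (p * up + q * um)| ≤ (|vt + 1 / 2 * f2 - b * f1 - c * u| + (2 * K + 5 * K ^ 2) / n) / n := by
  have hn0 : 0 < n := by linarith
  set D := σ * (up - um) / 2 with hD
  set L := n * (up + um - 2 * u) with hL
  set P := vt + 1 / 2 * f2 - b * f1 - c * u with hP
  set E := n * (u0 - u) + cN * u0 - L / 2 + bN * D with hE
  have id1 : n * (u0 - (p * up + q * um)) = (p + q) * E := by
    rw [hE, hD, hL]
    linear_combination (-u0) * hc - σ * (up - um) / 2 * hb + (p - q) * (up - um) / 2 * hsq
  have id2 : E = -P + ((n * (u0 - u) + vt) - (c - cN) * u0 + c * (u0 - u) - (L - f2) / 2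
      - (b - bN) * D + b * (D - f1)) := by
    rw [hE, hP]; ring
  have hKn : K / n ≤ K := div_le_self hK hn
  have hKn0 : 0 ≤ K / n := by positivity
  have hDb : |D| ≤ 2 * K := by
    have := abs_sub_abs_le_abs_sub D f1; linarith
  have m1 : |(c - cN) * u0| ≤ K / n * K := by rw [abs_mul]; gcongr
  have m2 : |c * (u0 - u)| ≤ K * (K / n) := by rw [abs_mul]; gcongr
  have m3 : |(b - bN) * D| ≤ K / n * (2 * K) := by rw [abs_mul]; gcongr
  have m4 : |b * (D - f1)| ≤ K * (K / n) := by rw [abs_mul]; gcongr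
  have tot : (2 * K + 5 * K ^ 2) / n
      = K / n + K / n * K + K * (K / n) + (2 * K / n) / 2 + K / n * (2 * K) + K * (K / n) := by
    ring
  have hEb : |E| ≤ |P| + (2 * K + 5 * K ^ 2) / n := by
    rw [id2, tot]
    rw [abs_le] at *
    have := neg_abs_le P
    have := le_abs_self P
    constructor <;> linarith [m1.1, m2.1, m3.1, m4.1, m1.2, m2.2, m3.2, m4.2]
  rw [le_div_iff₀ hn0]
  calc |u0 - (p * up + q * um)| * n = |n * (u0 - (p * up + q * um))| := by
        rw [abs_mul, abs_of_pos hn0, mul_comm]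
    _ = (p + q) * |E| := by rw [id1, abs_mul, abs_of_pos ha]
    _ ≤ 1 * |E| := by gcongr
    _ ≤ _ := by rw [one_mul]; exact hEb

theorem aux_time {T K : ℝ} {g gt gtt : ℝ → ℝ}
    (h1 : ∀ t ∈ Set.Icc 0 T, HasDerivAt g (gt t) t)
    (h2 : ∀ t ∈ Set.Icc 0 T, HasDerivAt gt (gtt t) t)
    (hb : ∀ t ∈ Set.Icc 0 T, |gt t| ≤ K ∧ |gtt t| ≤ K)
    {s t : ℝ} (hs : 0 ≤ s) (hst : s ≤ t) (ht : t ≤ T) :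
    |g s - g t| ≤ K * (t - s) ∧ |g s - g t + (t - s) * gt t| ≤ K * (t - s) * (t - s) := by
  have mem : ∀ r ∈ Set.Icc s t, r ∈ Set.Icc 0 T := fun r hr => ⟨hs.trans hr.1, hr.2.trans ht⟩
  have A := norm_image_sub_le_of_norm_deriv_le_segment' (f := g) (f' := gt) (C := K)
    (a := s) (b := t) (fun x hx => (h1 x (mem x hx)).hasDerivWithinAt)
    (fun x hx => (hb x (mem x ⟨hx.1, hx.2.le⟩)).1) t ⟨hst, le_rfl⟩
  have B : ∀ r ∈ Set.Icc s t, |gt t - gt r| ≤ K * (t - r) := by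
    intro r hr
    exact norm_image_sub_le_of_norm_deriv_le_segment' (f := gt) (f' := gtt) (C := K)
      (a := r) (b := t) (fun x hx => (h2 x (mem x ⟨hr.1.trans hx.1, hx.2⟩)).hasDerivWithinAt)
      (fun x hx => (hb x (mem x ⟨hr.1.trans hx.1, hx.2.le⟩)).2) t ⟨hr.2, le_rfl⟩
  have hK : 0 ≤ K := (abs_nonneg _).trans (hb s (mem s ⟨le_rfl, hst⟩)).1
  have D := norm_image_sub_le_of_norm_deriv_le_segment' (f := fun r => g r - r * gt t)
    (f' := fun r => gt r - gt t) (C := K * (t - s))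
    (a := s) (b := t) (fun x hx => by
      have := ((h1 x (mem x hx)).sub ((hasDerivAt_id x).mul_const (gt t))).hasDerivWithinAt
        (s := Set.Icc s t)
      exact this.congr_deriv (by ring))
    (fun x hx => by
      rw [Real.norm_eq_abs, abs_sub_comm]
      refine (B x ⟨hx.1, hx.2.le⟩).trans ?_
      have := hx.1
      gcongr) t ⟨hst, le_rfl⟩
  rw [Real.norm_eq_abs, abs_sub_comm] at A D
  refine ⟨A, ?_⟩
  convert D using 2
  ring

theorem aux_avg {p q X Y e : ℝ} (hp : 0 < p) (hq : 0 < q) (ha : p + q < 1)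
    (e1 : |X| ≤ e) (e2 : |Y| ≤ e) : |p * X + q * Y| ≤ e := by
  have he0 : 0 ≤ e := (abs_nonneg _).trans e1
  refine (abs_add_le _ _).trans ?_
  rw [abs_mul, abs_mul, abs_of_pos hp, abs_of_pos hq]
  nlinarith [mul_le_mul_of_nonneg_left e1 hp.le, mul_le_mul_of_nonneg_left e2 hq.le]

theorem aux_div {n X Y K : ℝ} (hn : 0 < n) (h : n * (X + Y) ≤ K) (hY : 0 ≤ Y) :
    X ≤ K / n := by
  rw [le_div_iff₀ hn]
  nlinarith

theorem aux_pb {K vt f2 b f1 c u : ℝ} (hK : 0 ≤ K) (q0 : |vt| ≤ K) (g2 : |f2| ≤ K)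
    (hB : |b| ≤ K) (g1 : |f1| ≤ K) (hC : |c| ≤ K) (g0 : |u| ≤ K) :
    |vt + 1 / 2 * f2 - b * f1 - c * u| ≤ 2 * K + 2 * K ^ 2 := by
  have q1 : |b * f1| ≤ K * K := by rw [abs_mul]; gcongr
  have q2 : |c * u| ≤ K * K := by rw [abs_mul]; gcongr
  rw [abs_le] at *
  constructor <;> linarith [q1.1, q2.1, q1.2, q2.2, q0.1, q0.2, g2.1, g2.2]

/-- Order-`N⁻¹` convergence in dimension one for the symmetric walk: under no-arbitrage,
completeness, positive interest rate, order-`N⁻¹` approximation of the coefficients and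
payoff, and a regular bounded solution `ν` of `∂ν/∂t + (1/2)ν'' − bν' − cν = 0`, `ν(T,·) = Φ`,
the discrete prices satisfy `|ν(t,x) − v^N(t,x)| ≤ C N⁻¹` on the grid `k/N`, `k ≤ M N := ⌊TN⌋`. -/
theorem convergence_order_one_dim {T : ℝ} (hT : 0 < T)
    (M : ℕ → ℕ) (hM : ∀ N : ℕ, M N = Nat.floor (T * N))
    (h : ℕ → ℕ → ℝ → Fin 2 → ℝ) (ΦN : ℕ → ℝ → ℝ) (v : ℕ → ℕ → ℝ → ℝ)
    -- (i) no arbitrage and completeness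
    (hinv : ∀ N : ℕ, 1 ≤ N → ∀ k ≤ M N, ∀ x, IsUnit (Hmat1 N (h N k) x).det)
    (hNA : ∀ N : ℕ, 1 ≤ N → ∀ k < M N, ∀ x, ∀ j,
        0 < Matrix.vecMul (h N k x) (Hmat1 N (h N (k + 1)) x)⁻¹ j)
    -- (ii) positive interest rate: 0 < A < 1
    (hA : ∀ N : ℕ, 1 ≤ N → ∀ k < M N, ∀ x,
        0 < ∑ j, Matrix.vecMul (h N k x) (Hmat1 N (h N (k + 1)) x)⁻¹ j ∧
          ∑ j, Matrix.vecMul (h N k x) (Hmat1 N (h N (k + 1)) x)⁻¹ j < 1)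
    -- coefficients of the limit PDE, approximated at order N⁻¹
    (b c : ℝ → ℝ → ℝ) (Φ : ℝ → ℝ)
    (hbcΦbdd : ∃ C, ∀ t x, |b t x| ≤ C ∧ |c t x| ≤ C ∧ |Φ x| ≤ C)
    (happrox : ∃ C, ∀ N : ℕ, 1 ≤ N →
        (∀ k, 1 ≤ k → k ≤ M N → ∀ x,
          (N : ℝ) * (|b ((k : ℝ) / N) x - coeffs1 N (h N (k - 1)) (h N k) x 1|
            + |c ((k : ℝ) / N) x - coeffs1 N (h N (k - 1)) (h N k) x 0|) ≤ C) ∧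
        ∀ x, (N : ℝ) * |Φ x - ΦN N x| ≤ C)
    -- regular bounded solution of the limit PDE, C^{2,4}
    (ν νt νtt : ℝ → ℝ → ℝ)
    (hνbdd : ∃ C, ∀ t ∈ Set.Icc 0 T, ∀ x, |ν t x| ≤ C)
    (hsp : ∀ t ∈ Set.Icc 0 T, ContDiff ℝ 4 (ν t))
    (hspb : ∃ C, ∀ i ≤ 4, ∀ t ∈ Set.Icc 0 T, ∀ x, |iteratedDeriv i (ν t) x| ≤ C)
    (hνt : ∀ t ∈ Set.Icc 0 T, ∀ x, HasDerivAt (fun s => ν s x) (νt t x) t)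
    (hνtt : ∀ t ∈ Set.Icc 0 T, ∀ x, HasDerivAt (fun s => νt s x) (νtt t x) t)
    (hνtb : ∃ C, ∀ t ∈ Set.Icc 0 T, ∀ x, |νt t x| ≤ C ∧ |νtt t x| ≤ C)
    (hPDE : ∀ t, 0 ≤ t → t < T → ∀ x,
        νt t x + (1 / 2) * deriv (deriv (ν t)) x - b t x * deriv (ν t) x
          - c t x * ν t x = 0)
    (hterm : ∀ x, ν T x = Φ x)
    -- the discrete pricing recursion
    (hvterm : ∀ N : ℕ, 1 ≤ N → ∀ x, v N (M N) x = ΦN N x)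
    (hvrec : ∀ N : ℕ, 1 ≤ N → ∀ k < M N, ∀ x, v N k x =
        ∑ i, Matrix.vecMul (h N k x) (Hmat1 N (h N (k + 1)) x)⁻¹ i
          * v N (k + 1) (x + (Real.sqrt N)⁻¹ * sgn1 i)) :
    ∃ C, ∀ N : ℕ, 1 ≤ N → ∀ k ≤ M N, ∀ x,
      |ν ((k : ℝ) / N) x - v N k x| ≤ C / N := by
  obtain ⟨C1, hC1⟩ := hbcΦbdd
  obtain ⟨C2, hC2⟩ := happrox
  obtain ⟨C3, hC3⟩ := hspb
  obtain ⟨C4, hC4⟩ := hνtb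
  obtain ⟨K, hK0, k1, k2, k3, k4⟩ : ∃ K : ℝ, 0 ≤ K ∧ C1 ≤ K ∧ C2 ≤ K ∧ C3 ≤ K ∧ C4 ≤ K := by
    refine ⟨|C1| + |C2| + |C3| + |C4|, by positivity, ?_, ?_, ?_, ?_⟩ <;>
    linarith [le_abs_self C1, le_abs_self C2, le_abs_self C3, le_abs_self C4,
      abs_nonneg C1, abs_nonneg C2, abs_nonneg C3, abs_nonneg C4]
  set D1 := 2 * K + 5 * K ^ 2 with hD1
  set D2 := 2 * K + 2 * K ^ 2 with hD2
  have hD10 : 0 ≤ D1 := by positivity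
  have hD20 : 0 ≤ D2 := by positivity
  refine ⟨2 * K + D2 + T * D1, fun N hN => ?_⟩
  have hn : (1 : ℝ) ≤ N := by exact_mod_cast hN
  have hn0 : (0 : ℝ) < N := by linarith
  have hsq : Real.sqrt N * Real.sqrt N = N := Real.mul_self_sqrt hn0.le
  have hMle : (M N : ℝ) ≤ T * N := by rw [hM]; exact Nat.floor_le (by positivity)
  have hMgt : T * N < M N + 1 := by rw [hM]; exact Nat.lt_floor_add_one _
  have hmem : ∀ k : ℕ, k ≤ M N → (k : ℝ) / N ∈ Set.Icc 0 T := by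
    intro k hk
    refine ⟨by positivity, ?_⟩
    rw [div_le_iff₀ hn0]
    exact le_trans (by exact_mod_cast hk) hMle
  have hder : ∀ t ∈ Set.Icc 0 T, ∀ x, |ν t x| ≤ K ∧ |deriv (ν t) x| ≤ K
      ∧ |deriv (deriv (ν t)) x| ≤ K := by
    intro t ht x
    have a0 := hC3 0 (by norm_num) t ht x
    have a1 := hC3 1 (by norm_num) t ht x
    have a2 := hC3 2 (by norm_num) t ht x
    rw [iteratedDeriv_zero] at a0
    rw [iteratedDeriv_one] at a1
    rw [iteratedDeriv_succ, iteratedDeriv_one] at a2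
    exact ⟨a0.trans k3, a1.trans k3, a2.trans k3⟩
  have htime : ∀ x, ∀ s t : ℝ, 0 ≤ s → s ≤ t → t ≤ T →
      |ν s x - ν t x| ≤ K * (t - s) ∧
      |ν s x - ν t x + (t - s) * νt t x| ≤ K * (t - s) * (t - s) := fun x s t hs hst ht =>
    aux_time (fun t ht => hνt t ht x) (fun t ht => hνtt t ht x)
      (fun t ht => ⟨(hC4 t ht x).1.trans k4, (hC4 t ht x).2.trans k4⟩) hs hst ht
  -- one step
  have hstep : ∀ k < M N, ∀ x e, (∀ y, |ν (((k + 1 : ℕ) : ℝ) / N) y - v N (k + 1) y| ≤ e) →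
      |ν ((k : ℝ) / N) x - v N k x| ≤
        e + ((if k + 1 = M N then D2 else 0) + D1 / N) / N := by
    intro k hk x e he
    have hnna := hNA N hN k hk x
    have haa := hA N hN k hk x
    have hv := hvrec N hN k hk x
    have hcf := aux_coeff N hN (h N k) (h N (k + 1)) x (hinv N hN (k + 1) hk x) _ _ rfl rfl
      (by have := haa.1; rwa [Fin.sum_univ_two] at this)
    have hp0 := hnna 0
    have hq0 := hnna 1
    rw [Fin.sum_univ_two] at haa hv
    generalize Matrix.vecMul (h N k x) (Hmat1 N (h N (k + 1)) x)⁻¹ 0 = p at *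
    generalize Matrix.vecMul (h N k x) (Hmat1 N (h N (k + 1)) x)⁻¹ 1 = q at *
    have hap := (hC2 N hN).1 (k + 1) (by omega) hk x
    simp only [Nat.add_sub_cancel] at hap
    have ht := hmem (k + 1) hk
    have hs := hmem k hk.le
    have hts : (((k + 1 : ℕ) : ℝ) / N) - (k : ℝ) / N = 1 / N := by push_cast; ring
    have hst : (k : ℝ) / N ≤ ((k + 1 : ℕ) : ℝ) / N := by
      have : (0 : ℝ) ≤ 1 / N := by positivity
      linarith
    obtain ⟨tt1, tt2⟩ := htime x _ _ hs.1 hst ht.2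
    rw [hts] at tt1 tt2
    set t := ((k + 1 : ℕ) : ℝ) / N with htdef
    obtain ⟨sp1, sp2⟩ := aux_spatial (hsp t ht)
      (fun i hi y => (hC3 i hi t ht y).trans k3) N hN x
    have hbn : |b t x - coeffs1 N (h N k) (h N (k + 1)) x 1| ≤ K / N := by
      exact aux_div hn0 (hap.trans k2) (abs_nonneg _)
    have hcn : |c t x - coeffs1 N (h N k) (h N (k + 1)) x 0| ≤ K / N := by
      have hap2 := hap
      rw [add_comm |b t x - _|] at hap2
      exact aux_div hn0 (hap2.trans k2) (abs_nonneg _)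
    have hB := (hC1 t x).1.trans k1
    have hC := (hC1 t x).2.1.trans k1
    obtain ⟨g0, g1, g2⟩ := hder t ht x
    have key := aux_step (vt := νt t x) hn hK0 hsq haa.1 haa.2 hcf.1 hcf.2 hbn hcn hB hC
      (hder _ hs x).1 g1 sp1 sp2 (by rw [mul_one_div] at tt1; exact tt1)
      (by
        have : (N : ℝ) * (ν ((k : ℝ) / N) x - ν t x) + νt t x
          = N * (ν ((k : ℝ) / N) x - ν t x + 1 / N * νt t x) := by field_simp
        rw [this, abs_mul, abs_of_pos hn0]
        refine (mul_le_mul_of_nonneg_left tt2 hn0.le).trans (le_of_eq ?_)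
        field_simp)
    have hPb : |νt t x + 1 / 2 * deriv (deriv (ν t)) x - b t x * deriv (ν t) x - c t x * ν t x|
        ≤ if k + 1 = M N then D2 else 0 := by
      split_ifs with hkM
      · exact aux_pb hK0 ((hC4 t ht x).1.trans k4) g2 hB g1 hC g0
      · have hlt : t < T := by
          have : ((k + 1 : ℕ) : ℝ) + 1 ≤ M N := by
            exact_mod_cast Nat.lt_of_le_of_ne hk hkM
          rw [htdef, div_lt_iff₀ hn0]; linarith
        rw [hPDE t ht.1 hlt x, abs_zero]
    have hs0 : sgn1 0 = 1 := by simp [sgn1]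
    have hs1 : sgn1 1 = -1 := by simp [sgn1]
    rw [hs0, hs1, mul_one, mul_neg_one, ← sub_eq_add_neg] at hv
    set xp := x + (Real.sqrt N)⁻¹
    set xm := x - (Real.sqrt N)⁻¹
    have e1 := he xp
    have e2 := he xm
    have he0 : 0 ≤ e := (abs_nonneg _).trans e1
    have hL : |p * (ν t xp - v N (k + 1) xp) + q * (ν t xm - v N (k + 1) xm)| ≤ e := by
      exact aux_avg hp0 hq0 haa.2 e1 e2
    have split : ν ((k : ℝ) / N) x - v N k x
        = (p * (ν t xp - v N (k + 1) xp) + q * (ν t xm - v N (k + 1) xm))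
          + (ν ((k : ℝ) / N) x - (p * ν t xp + q * ν t xm)) := by
      rw [hv]; ring
    rw [split]
    refine (abs_add_le _ _).trans (add_le_add hL (key.trans ?_))
    gcongr
  have hbase : ∀ x, |ν ((M N : ℝ) / N) x - v N (M N) x| ≤ 2 * K / N := by
    intro x
    have hm := hmem (M N) le_rfl
    have a1 := (htime x _ T hm.1 hm.2 le_rfl).1
    have a2 := (hC2 N hN).2 x
    rw [hvterm N hN x]
    rw [hterm x] at a1
    have a3 : |Φ x - ΦN N x| ≤ K / N := by rw [le_div_iff₀ hn0]; linarith
    have a4 : T - (M N : ℝ) / N ≤ 1 / N := by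
      rw [sub_le_iff_le_add, ← add_div, le_div_iff₀ hn0]; linarith
    have a5 := mul_le_mul_of_nonneg_left a4 hK0
    have a6 := abs_sub_le (ν ((M N : ℝ) / N) x) (Φ x) (ΦN N x)
    have a7 : 2 * K / N = K * (1 / N) + K / N := by ring
    linarith
  have hind : ∀ j : ℕ, ∀ k : ℕ, k + j = M N → ∀ x, |ν ((k : ℝ) / N) x - v N k x| ≤
      (2 * K + (if j = 0 then 0 else D2) + j * (D1 / N)) / N := by
    intro j
    induction j with
    | zero =>
      intro k hk x
      have : k = M N := by omega
      subst this
      simpa using hbase x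
    | succ j ih =>
      intro k hk x
      refine (hstep k (by omega) x _ (ih (k + 1) (by omega))).trans (le_of_eq ?_)
      rw [← add_div]
      congr 1
      by_cases hj : j = 0
      · subst hj
        have : k + 1 = M N := by omega
        simp [this]; ring
      · have : k + 1 ≠ M N := by omega
        simp [this, hj]; ring
  intro k hk x
  obtain ⟨j, hj⟩ := Nat.exists_eq_add_of_le hk
  refine (hind j k hj.symm x).trans ?_
  have hjM : (j : ℝ) ≤ T * N := le_trans (by exact_mod_cast (by omega : j ≤ M N)) hMle
  have : (j : ℝ) * (D1 / N) ≤ T * D1 := by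
    calc (j : ℝ) * (D1 / N) ≤ T * N * (D1 / N) := by gcongr
      _ = T * D1 := by field_simp
  have : (if j = 0 then 0 else D2) ≤ D2 := by split_ifs <;> linarith
  gcongr
end
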